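/- arXiv:2401.12190 — 3 statements merged into one kernel-verified Lean document; each statement's English description precedes it below -/
import Mathlib

section
/- Let n ≥ 3 be an integer, ρ ∈ (-1,1), and let R be a real random variable with law f_{n,ρ}. Then |E[R] - ρ| ≤ |ρ|/n ≤ 1/n; in particular the bias of the sample correlation coefficient is of order O(n^{-1}). -/
open MeasureTheory Real

/-- Fisher's density of the sample correlation coefficient of a size-`n` sample from a
bivariate normal distribution with population correlation `ρ`. -/
noncomputable def fisherDensity (n : ℕ) (ρ : ℝ) (r : ℝ) : ℝ :=
  if |r| < 1 then
    (2 ^ ((n : ℝ) - 3) * (1 - ρ ^ 2) ^ (((n : ℝ) - 1) / 2) *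
        (1 - r ^ 2) ^ (((n : ℝ) - 4) / 2) / (π * Gamma ((n : ℝ) - 2))) *
      ∑' k : ℕ, (Gamma (((n : ℝ) - 1 + (k : ℝ)) / 2)) ^ 2 * (2 * r * ρ) ^ k / (Nat.factorial k : ℝ)
  else 0



lemma aux_gamma_logconv {x : ℝ} (hx : 0 < x) :
    Gamma (x + 1 / 2) ^ 2 ≤ Gamma x * Gamma (x + 1) := by
  have h := Gamma_mul_add_mul_le_rpow_Gamma_mul_rpow_Gamma hx (show 0 < x + 1 by linarith)
    (show (0 : ℝ) < 1 / 2 by norm_num) (show (0 : ℝ) < 1 / 2 by norm_num) (by norm_num)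
  rw [show 1 / 2 * x + 1 / 2 * (x + 1) = x + 1 / 2 by ring] at h
  have h0 := (Gamma_pos_of_pos hx).le
  have h1 := (Gamma_pos_of_pos (show 0 < x + 1 by linarith)).le
  have h2 := (Gamma_pos_of_pos (show 0 < x + 1 / 2 by linarith)).le
  rw [← sqrt_eq_rpow, ← sqrt_eq_rpow] at h
  calc _ ≤ (√(Gamma x) * √(Gamma (x + 1))) ^ 2 := by gcongr
    _ = _ := by rw [mul_pow, sq_sqrt h0, sq_sqrt h1]

lemma aux_gamma_lower {x : ℝ} (hx : 0 < x) :
    (1 - 1 / (2 * x + 1)) * Gamma x ≤ Gamma (x + 1 / 2) ^ 2 / Gamma (x + 1) := by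
  have h := aux_gamma_logconv (show 0 < x + 1 / 2 by linarith)
  rw [Gamma_add_one (by positivity), show x + 1 / 2 + 1 / 2 = x + 1 by ring] at h
  have h0 := Gamma_pos_of_pos hx
  rw [le_div_iff₀ (Gamma_pos_of_pos (by linarith))]
  have e := Gamma_add_one hx.ne'
  have : (1 - 1 / (2 * x + 1)) * Gamma x = Gamma (x + 1) / (x + 1 / 2) := by
    rw [e]; field_simp; ring
  rw [this, div_mul_eq_mul_div, div_le_iff₀ (by positivity)]
  nlinarith

lemma aux_gamma_upper {x : ℝ} (hx : 0 < x) :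
    Gamma (x + 1 / 2) ^ 2 / Gamma (x + 1) ≤ Gamma x := by
  rw [div_le_iff₀ (Gamma_pos_of_pos (by linarith))]
  exact aux_gamma_logconv hx

lemma aux_summable_binom {x u : ℝ} (hx : 0 < x) (hu : 0 ≤ u) (hu1 : u < 1) :
    Summable (fun j : ℕ => Gamma (x + j) * u ^ j / (Nat.factorial j : ℝ)) := by
  obtain ⟨r, hr0, hr1⟩ := exists_between hu1
  refine summable_of_ratio_norm_eventually_le hr1 ?_
  have ht := (tendsto_add_mul_div_add_mul_atTop_nhds x 1 1 (one_ne_zero (α := ℝ))).mul_const u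
  rw [div_one, one_mul] at ht
  filter_upwards [ht.eventually_le_const hr0] with j hj
  have hp : 0 < x + j := by positivity
  have hg := Gamma_pos_of_pos hp
  have hg1 := Gamma_pos_of_pos (show 0 < x + (j + 1 : ℕ) by positivity)
  rw [norm_of_nonneg (by positivity), norm_of_nonneg (by positivity)]
  have : Gamma (x + (j + 1 : ℕ)) = (x + j) * Gamma (x + j) := by
    rw [← Gamma_add_one hp.ne']; push_cast; ring_nf
  rw [this, Nat.factorial_succ]
  push_cast
  calc _ = ((x + 1 * j) / (1 + 1 * j) * u) * (Gamma (x + j) * u ^ j / (Nat.factorial j : ℝ)) := by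
        field_simp; ring
    _ ≤ _ := by gcongr

lemma aux_binom {x u : ℝ} (hx : 0 < x) (hu : 0 ≤ u) (hu1 : u < 1) :
    HasSum (fun j : ℕ => Gamma (x + j) * u ^ j / (Nat.factorial j : ℝ))
      (Gamma x * (1 - u) ^ (-x)) := by
  have hint : ∀ j : ℕ, Integrable (fun t : ℝ => (t ^ (x + j - 1) * exp (-t)) * (u ^ j / (Nat.factorial j : ℝ)))
      (volume.restrict (Set.Ioi 0)) := by
    intro j
    have := GammaIntegral_convergent (show 0 < x + j by positivity)
    refine (Integrable.mul_const ?_ _)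
    simpa [mul_comm, IntegrableOn] using this
  have hval : ∀ j : ℕ, ∫ t in Set.Ioi (0:ℝ), (t ^ (x + j - 1) * exp (-t)) * (u ^ j / (Nat.factorial j : ℝ))
      = Gamma (x + j) * u ^ j / (Nat.factorial j : ℝ) := by
    intro j
    rw [integral_mul_const, Gamma_eq_integral (show 0 < x + j by positivity), mul_div_assoc]
    simp_rw [mul_comm]
  have hn : ∀ j : ℕ, ∫ t in Set.Ioi (0:ℝ), ‖(t ^ (x + j - 1) * exp (-t)) * (u ^ j / (Nat.factorial j : ℝ))‖
      = Gamma (x + j) * u ^ j / (Nat.factorial j : ℝ) := by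
    intro j
    rw [← hval j]
    refine setIntegral_congr_fun measurableSet_Ioi fun t ht => ?_
    have : 0 < t := ht
    exact norm_of_nonneg (by positivity)
  have key := hasSum_integral_of_summable_integral_norm hint
    (by simp_rw [hn]; exact aux_summable_binom hx hu hu1)
  simp_rw [hval] at key
  have := integral_rpow_mul_exp_neg_mul_Ioi hx (show 0 < 1 - u by linarith)
  rw [one_div, inv_rpow (by linarith), ← rpow_neg (by linarith), mul_comm] at this
  suffices hs : (∫ (a : ℝ) in Set.Ioi 0, ∑' (i : ℕ), a ^ (x + ↑i - 1) * rexp (-a) *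
      (u ^ i / (Nat.factorial i : ℝ))) = Gamma x * (1 - u) ^ (-x) by
    rw [← hs]; exact key
  rw [← this]
  refine setIntegral_congr_fun measurableSet_Ioi fun t ht => ?_
  have ht : 0 < t := ht
  have h1 : ∀ j : ℕ, t ^ (x + j - 1) * exp (-t) * (u ^ j / (Nat.factorial j : ℝ))
      = t ^ (x - 1) * exp (-t) * ((u * t) ^ j / (Nat.factorial j : ℝ)) := by
    intro j
    rw [show x + j - 1 = (x - 1) + j by ring, rpow_add ht, rpow_natCast, mul_pow]; ring
  simp_rw [h1]
  rw [tsum_mul_left]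
  have : ∑' j : ℕ, (u * t) ^ j / (Nat.factorial j : ℝ) = exp (u * t) := by
    rw [Real.exp_eq_exp_ℝ, NormedSpace.exp_eq_tsum_div]
  rw [this, mul_assoc, ← exp_add]; ring_nf

lemma aux_summable_K {x ρ : ℝ} (hx : 0 < x) (h1 : |ρ| < 1) (i : ℕ) :
    Summable (fun j : ℕ => |Gamma (x + j) ^ 2 * (2 * ρ) ^ (2 * j + i) / (Nat.factorial (2 * j + i) : ℝ)|) := by
  have hu : ρ ^ 2 < 1 := by rwa [sq_lt_one_iff_abs_lt_one]
  obtain ⟨r, hr0, hr1⟩ := exists_between hu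
  refine summable_of_ratio_norm_eventually_le hr1 ?_
  have ht := ((tendsto_add_mul_div_add_mul_atTop_nhds (2 * x) (i + 1) 2 (two_ne_zero (α := ℝ))).mul
    (tendsto_add_mul_div_add_mul_atTop_nhds (2 * x) (i + 2) 2 (two_ne_zero (α := ℝ)))).mul_const (ρ ^ 2)
  rw [div_self two_ne_zero, one_mul, one_mul] at ht
  filter_upwards [ht.eventually_le_const hr0] with j hj
  have hp : 0 < x + j := by positivity
  have hg := Gamma_pos_of_pos hp
  have : Gamma (x + (j + 1 : ℕ)) = (x + j) * Gamma (x + j) := by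
    rw [← Gamma_add_one hp.ne']; push_cast; ring_nf
  rw [this, show 2 * (j + 1) + i = (2 * j + i) + 1 + 1 by ring, Nat.factorial_succ, Nat.factorial_succ]
  rw [norm_eq_abs, norm_eq_abs, abs_abs, abs_abs]
  have e : ((x + j) * Gamma (x + j)) ^ 2 * (2 * ρ) ^ (2 * j + i + 1 + 1) /
      (((2 * j + i + 1 + 1) * ((2 * j + i + 1) * (Nat.factorial (2 * j + i))) : ℕ) : ℝ)
      = ((2 * x + 2 * j) / (i + 1 + 2 * j) * ((2 * x + 2 * j) / (i + 2 + 2 * j)) * ρ ^ 2) *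
       (Gamma (x + j) ^ 2 * (2 * ρ) ^ (2 * j + i) / (Nat.factorial (2 * j + i) : ℝ)) := by
    push_cast
    have a1 : (2 * (j:ℝ) + i + 1 + 1) ≠ 0 := by positivity
    have a2 : (2 * (j:ℝ) + i + 1) ≠ 0 := by positivity
    have a3 : (i + 1 + 2 * (j:ℝ)) ≠ 0 := by positivity
    have a4 : (i + 2 + 2 * (j:ℝ)) ≠ 0 := by positivity
    rw [show (i + 1 + 2 * (j:ℝ)) = 2 * (j:ℝ) + i + 1 by ring,
      show (i + 2 + 2 * (j:ℝ)) = 2 * (j:ℝ) + i + 1 + 1 by ring]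
    field_simp
    ring
  rw [e, abs_mul, abs_of_nonneg (by positivity)]
  gcongr

noncomputable def auxW (a r : ℝ) : ℝ := if |r| < 1 then (1 - r ^ 2) ^ a else 0

lemma auxW_nonneg (a r : ℝ) : 0 ≤ auxW a r := by
  unfold auxW
  split_ifs with h
  · have : r ^ 2 < 1 := by rwa [sq_lt_one_iff_abs_lt_one]
    exact rpow_nonneg (by linarith) _
  · exact le_rfl

lemma auxW_measurable (a : ℝ) : Measurable (auxW a) := by
  unfold auxW
  refine Measurable.ite ?_ (by fun_prop) (by fun_prop)
  exact measurableSet_lt (by fun_prop) (by fun_prop)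

lemma aux_beta_integral {α β : ℝ} (hα : 0 < α) (hβ : 0 < β) :
    ∫ x in Set.Ioi 0, ProbabilityTheory.betaPDFReal α β x = 1 := by
  rw [setIntegral_eq_integral_of_forall_compl_eq_zero]
  · rw [integral_eq_lintegral_of_nonneg_ae]
    · have := ProbabilityTheory.lintegral_betaPDF_eq_one hα hβ
      unfold ProbabilityTheory.betaPDF at this
      rw [this]; simp
    · refine Filter.Eventually.of_forall fun x => ?_
      by_cases h : 0 < x ∧ x < 1
      · exact (ProbabilityTheory.betaPDFReal_pos h.1 h.2 hα hβ).le
      · simp [ProbabilityTheory.betaPDFReal, h]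
    · exact (ProbabilityTheory.measurable_betaPDFReal _ _).aestronglyMeasurable
  · intro x hx
    have : ¬ 0 < x := hx
    simp [ProbabilityTheory.betaPDFReal, this]

lemma aux_J_even {a : ℝ} (ha : -1 < a) (j : ℕ) :
    ∫ r, r ^ (2 * j) * auxW a r = ProbabilityTheory.beta (j + 1 / 2) (a + 1) := by
  have h1 : (0:ℝ) < j + 1 / 2 := by positivity
  have h2 : 0 < a + 1 := by linarith
  have hb := ProbabilityTheory.beta_pos h1 h2
  have e : ∀ r : ℝ, r ^ (2 * j) * auxW a r = (fun x => x ^ (2 * j) * auxW a x) |r| := by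
    intro r
    simp only [auxW, abs_abs, sq_abs, pow_mul]
  rw [integral_congr_ae (Filter.Eventually.of_forall e),
    integral_comp_abs (f := fun x => x ^ (2 * j) * auxW a x), ← integral_const_mul]
  have h3 := integral_comp_rpow_Ioi_of_pos
    (g := fun x => ProbabilityTheory.betaPDFReal (j + 1 / 2) (a + 1) x) (p := 2) two_pos
  rw [aux_beta_integral h1 h2] at h3
  have h4 := congrArg (fun z => ProbabilityTheory.beta (j + 1 / 2) (a + 1) * z) h3
  simp only [mul_one] at h4
  rw [← integral_const_mul] at h4
  refine Eq.trans ?_ h4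
  refine setIntegral_congr_fun measurableSet_Ioi fun x hx => ?_
  have hx : 0 < x := hx
  simp only [auxW, ProbabilityTheory.betaPDFReal, rpow_two, abs_of_pos hx, smul_eq_mul]
  have hx2 : 0 < x ^ 2 := by positivity
  have hiff : x ^ 2 < 1 ↔ x < 1 := by rw [sq_lt_one_iff_abs_lt_one, abs_of_pos hx]
  by_cases h : x < 1
  · simp only [h, hx2, hiff, and_self, if_true]
    have e2 : (x ^ 2) ^ ((j : ℝ) + 1 / 2 - 1) * x = x ^ (2 * j) := by
      rw [← rpow_natCast x 2, ← rpow_mul hx.le]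
      nth_rw 2 [← rpow_one x]
      rw [← rpow_add hx, ← rpow_natCast]
      congr 1; push_cast; ring
    rw [← e2, show a + 1 - 1 = a by ring, show (2:ℝ) - 1 = 1 by norm_num, rpow_one]
    generalize ProbabilityTheory.beta (j + 1 / 2) (a + 1) = b at *
    field_simp
  · simp [h, hiff]

lemma aux_J_odd (a : ℝ) (j : ℕ) : ∫ r, r ^ (2 * j + 1) * auxW a r = 0 := by
  have h := integral_neg_eq_self (fun r : ℝ => r ^ (2 * j + 1) * auxW a r) volume
  have e : ∀ r : ℝ, (-r) ^ (2 * j + 1) * auxW a (-r) = -(r ^ (2 * j + 1) * auxW a r) := by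
    intro r
    rw [Odd.neg_pow ⟨j, rfl⟩]
    simp only [auxW, abs_neg, neg_sq]
    split_ifs <;> simp
  simp_rw [e, integral_neg] at h
  linarith

lemma auxW_integrable {a : ℝ} (ha : -1 < a) : Integrable (auxW a) := by
  by_contra h
  have h1 := aux_J_even ha 0
  simp only [mul_zero, pow_zero, one_mul] at h1
  rw [integral_undef h] at h1
  exact (ProbabilityTheory.beta_pos (by norm_num) (by linarith)).ne h1

lemma auxW_bound (a r : ℝ) (q : ℕ) : |r ^ q * auxW a r| ≤ auxW a r := by
  rw [abs_mul, abs_of_nonneg (auxW_nonneg a r)]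
  by_cases h : |r| < 1
  · have : |r ^ q| ≤ 1 := by rw [abs_pow]; exact pow_le_one₀ (abs_nonneg _) h.le
    exact mul_le_of_le_one_left (auxW_nonneg a r) this
  · simp [auxW, h]

lemma auxW_pow_integrable {a : ℝ} (ha : -1 < a) (q : ℕ) :
    Integrable (fun r => r ^ q * auxW a r) := by
  refine (auxW_integrable ha).mono' ?_ (Filter.Eventually.of_forall fun r => auxW_bound a r q)
  exact ((measurable_id.pow_const q).mul (auxW_measurable a)).aestronglyMeasurable

lemma aux_moment {a : ℝ} (ha : -1 < a) {K : ℕ → ℝ} (hK : Summable fun k => |K k|) (p : ℕ) :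
    Integrable (fun r => ∑' k, K k * (r ^ (k + p) * auxW a r)) ∧
    HasSum (fun k => K k * ∫ r, r ^ (k + p) * auxW a r)
      (∫ r, ∑' k, K k * (r ^ (k + p) * auxW a r)) := by
  have hb : ∀ k r, ‖K k * (r ^ (k + p) * auxW a r)‖ ≤ |K k| * auxW a r := by
    intro k r
    rw [norm_mul, norm_eq_abs, norm_eq_abs]
    exact mul_le_mul_of_nonneg_left (auxW_bound a r _) (abs_nonneg _)
  have hint : ∀ k, Integrable (fun r => K k * (r ^ (k + p) * auxW a r)) :=
    fun k => (auxW_pow_integrable ha _).const_mul _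
  have hs : ∀ r, Summable fun k => |K k| * auxW a r := fun r => hK.mul_right _
  have hs' : ∀ r, Summable fun k => K k * (r ^ (k + p) * auxW a r) := fun r =>
    (hs r).of_norm_bounded (hb · r)
  constructor
  · refine ((auxW_integrable ha).const_mul (∑' k, |K k|)).mono' ?_ ?_
    · have hm : Measurable (fun r => ∑' k, K k * (r ^ (k + p) * auxW a r)) := by
        refine measurable_of_tendsto_metrizable
          (f := fun N r => ∑ k ∈ Finset.range N, K k * (r ^ (k + p) * auxW a r)) ?_ ?_
        · intro N
          have := auxW_measurable a
          fun_prop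
        · rw [tendsto_pi_nhds]
          intro r
          exact (hs' r).hasSum.tendsto_sum_nat
      exact hm.aestronglyMeasurable
    · refine Filter.Eventually.of_forall fun r => ?_
      rw [← tsum_mul_right]
      exact tsum_of_norm_bounded (hs r).hasSum (hb · r)
  · have := hasSum_integral_of_summable_integral_norm hint ?_
    · simpa only [integral_const_mul] using this
    · refine (hK.mul_right (∫ r, auxW a r)).of_nonneg_of_le
        (fun k => integral_nonneg fun r => norm_nonneg _) fun k => ?_
      rw [← integral_const_mul]
      exact integral_mono (hint k).norm ((auxW_integrable ha).const_mul _) (hb k)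

lemma aux_coef_const {m : ℝ} (hm : 1 ≤ m) (ρ : ℝ) :
    2 ^ (2 * m - 2) * (1 - ρ ^ 2) ^ m / (π * Gamma (2 * m - 1)) =
      (1 - ρ ^ 2) ^ m / (√π * Gamma (m - 1 / 2) * Gamma m) := by
  have h := Gamma_mul_Gamma_add_half (m - 1 / 2)
  rw [show m - 1 / 2 + 1 / 2 = m by ring, show 2 * (m - 1 / 2) = 2 * m - 1 by ring,
    show 1 - (2 * m - 1) = -(2 * m - 2) by ring, rpow_neg two_pos.le] at h
  have hp : (0:ℝ) < 2 ^ (2 * m - 2) := by positivity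
  have hg : 0 < Gamma (2 * m - 1) := Gamma_pos_of_pos (by linarith)
  have hpi : 0 < √π := by positivity
  have hpi2 : π = √π * √π := (mul_self_sqrt pi_pos.le).symm
  rw [mul_assoc, h]
  generalize (2:ℝ) ^ (2 * m - 2) = A at *
  rw [show √π * (Gamma (2 * m - 1) * A⁻¹ * √π) = (√π * √π) * Gamma (2 * m - 1) / A by
    field_simp, ← hpi2]
  field_simp

lemma aux_fact_even (j : ℕ) :
    Gamma (j + 1 / 2) * 4 ^ j / (Nat.factorial (2 * j) : ℝ) = √π / (Nat.factorial j : ℝ) := by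
  have h := Gamma_mul_Gamma_add_half ((j : ℝ) + 1 / 2)
  rw [show (j : ℝ) + 1 / 2 + 1 / 2 = j + 1 by ring, Gamma_nat_eq_factorial,
    show 2 * ((j : ℝ) + 1 / 2) = ((2 * j : ℕ) : ℝ) + 1 by push_cast; ring, Gamma_nat_eq_factorial,
    show 1 - (((2 * j : ℕ) : ℝ) + 1) = -((2 * j : ℕ) : ℝ) by ring, rpow_neg two_pos.le,
    rpow_natCast, pow_mul] at h
  norm_num at h
  have : (0:ℝ) < Nat.factorial (2 * j) := by positivity
  field_simp at h ⊢
  linarith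

lemma aux_fact_odd (j : ℕ) :
    Gamma (j + 1 + 1 / 2) * (4 ^ j * 2) / (Nat.factorial (2 * j + 1) : ℝ)
      = √π / (Nat.factorial j : ℝ) := by
  have h := Gamma_mul_Gamma_add_half ((j : ℝ) + 1)
  rw [Gamma_nat_eq_factorial,
    show 2 * ((j : ℝ) + 1) = ((2 * j + 1 : ℕ) : ℝ) + 1 by push_cast; ring, Gamma_nat_eq_factorial,
    show 1 - (((2 * j + 1 : ℕ) : ℝ) + 1) = -((2 * j + 1 : ℕ) : ℝ) by ring, rpow_neg two_pos.le,
    rpow_natCast, pow_succ, pow_mul] at h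
  norm_num at h
  have : (0:ℝ) < Nat.factorial (2 * j + 1) := by positivity
  field_simp at h ⊢
  linarith

lemma aux_even_coef {m : ℝ} (hm : 1 ≤ m) (ρ : ℝ) (j : ℕ) :
    (2 ^ (2 * m - 2) * (1 - ρ ^ 2) ^ m / (π * Gamma (2 * m - 1))) *
      (Gamma (m + j) ^ 2 * (2 * ρ) ^ (2 * j) / (Nat.factorial (2 * j) : ℝ)) *
      ProbabilityTheory.beta (j + 1 / 2) (m - 1 / 2) =
    (1 - ρ ^ 2) ^ m / Gamma m * (Gamma (m + j) * (ρ ^ 2) ^ j / (Nat.factorial j : ℝ)) := by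
  have h := aux_fact_even j
  have h1 : 0 < Gamma (m - 1 / 2) := Gamma_pos_of_pos (by linarith)
  have h2 : 0 < Gamma m := Gamma_pos_of_pos (by linarith)
  have h3 : 0 < Gamma (m + j) := Gamma_pos_of_pos (by positivity)
  have hpi : 0 < √π := by positivity
  rw [aux_coef_const hm, ProbabilityTheory.beta, show (j : ℝ) + 1 / 2 + (m - 1 / 2) = m + j by ring,
    mul_pow, pow_mul, pow_mul, show (2:ℝ) ^ 2 = 4 by norm_num]
  generalize Gamma (m - 1 / 2) = G at *
  calc _ = (1 - ρ ^ 2) ^ m / (√π * Gamma m) * Gamma (m + j) * (ρ ^ 2) ^ j *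
        (Gamma (j + 1 / 2) * 4 ^ j / (Nat.factorial (2 * j) : ℝ)) := by field_simp
    _ = _ := by rw [h]; field_simp

lemma aux_odd_coef {m : ℝ} (hm : 1 ≤ m) (ρ : ℝ) (j : ℕ) :
    (2 ^ (2 * m - 2) * (1 - ρ ^ 2) ^ m / (π * Gamma (2 * m - 1))) *
      (Gamma (m + 1 / 2 + j) ^ 2 * (2 * ρ) ^ (2 * j + 1) / (Nat.factorial (2 * j + 1) : ℝ)) *
      ProbabilityTheory.beta (j + 1 + 1 / 2) (m - 1 / 2) =
    ρ * ((1 - ρ ^ 2) ^ m / Gamma m * (Gamma (m + j + 1 / 2) ^ 2 / Gamma (m + j + 1) *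
      (ρ ^ 2) ^ j / (Nat.factorial j : ℝ))) := by
  have h := aux_fact_odd j
  have h1 : 0 < Gamma (m - 1 / 2) := Gamma_pos_of_pos (by linarith)
  have h2 : 0 < Gamma m := Gamma_pos_of_pos (by linarith)
  have h3 : 0 < Gamma (m + j + 1) := Gamma_pos_of_pos (by positivity)
  have hpi : 0 < √π := by positivity
  rw [aux_coef_const hm, ProbabilityTheory.beta,
    show (j : ℝ) + 1 + 1 / 2 + (m - 1 / 2) = m + j + 1 by ring,
    show m + 1 / 2 + (j : ℝ) = m + j + 1 / 2 by ring,
    mul_pow, pow_succ 2 (2 * j), pow_succ ρ (2 * j), pow_mul, pow_mul, show (2:ℝ) ^ 2 = 4 by norm_num]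
  generalize Gamma (m - 1 / 2) = G at *
  calc _ = (1 - ρ ^ 2) ^ m / (√π * Gamma m) * (Gamma (m + j + 1 / 2) ^ 2 / Gamma (m + j + 1)) *
        ((ρ ^ 2) ^ j * ρ) *
        (Gamma (j + 1 + 1 / 2) * (4 ^ j * 2) / (Nat.factorial (2 * j + 1) : ℝ)) := by field_simp
    _ = _ := by rw [h]; field_simp

/-- The bias of the sample correlation coefficient is `O(1/n)`. -/
theorem mean_bias_bound {Ω : Type*} [MeasurableSpace Ω] (P : Measure Ω) [IsProbabilityMeasure P]
    (n : ℕ) (hn : 3 ≤ n) (ρ : ℝ) (hρ : ρ ∈ Set.Ioo (-1 : ℝ) 1)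
    (R : Ω → ℝ) (hR : Measurable R)
    (hlaw : Measure.map R P = volume.withDensity fun r => ENNReal.ofReal (fisherDensity n ρ r)) :
    |(∫ ω, R ω ∂P) - ρ| ≤ |ρ| / (n : ℝ) ∧ |ρ| / (n : ℝ) ≤ 1 / (n : ℝ) := by
  obtain ⟨hρ1, hρ2⟩ := hρ
  have hn0 : (0:ℝ) < n := by positivity
  have hn3 : (3:ℝ) ≤ n := by exact_mod_cast hn
  have hρa : |ρ| < 1 := abs_lt.mpr ⟨hρ1, hρ2⟩
  refine ⟨?_, by gcongr⟩
  obtain ⟨m, hm⟩ : ∃ m : ℝ, m = ((n:ℝ) - 1) / 2 := ⟨_, rfl⟩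
  have hnm : (n:ℝ) = 2 * m + 1 := by linarith
  have hm1 : 1 ≤ m := by linarith
  have hm0 : 0 < m := by linarith
  have hu1 : ρ ^ 2 < 1 := by rwa [sq_lt_one_iff_abs_lt_one]
  have hu0 : 0 ≤ ρ ^ 2 := sq_nonneg ρ
  obtain ⟨a, haa⟩ : ∃ a : ℝ, a = m - 3 / 2 := ⟨_, rfl⟩
  have ha : -1 < a := by linarith
  have ha1 : a + 1 = m - 1 / 2 := by linarith
  obtain ⟨C, hC⟩ : ∃ C : ℝ, C = 2 ^ (2 * m - 2) * (1 - ρ ^ 2) ^ m / (π * Gamma (2 * m - 1)) :=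
    ⟨_, rfl⟩
  obtain ⟨K, hKdef⟩ : ∃ K : ℕ → ℝ, K = fun k : ℕ => C * (Gamma (m + (k : ℝ) / 2) ^ 2 * (2 * ρ) ^ k /
    (Nat.factorial k : ℝ)) := ⟨_, rfl⟩
  have hKe : ∀ j : ℕ, K (2 * j) = C * (Gamma (m + j) ^ 2 * (2 * ρ) ^ (2 * j) /
      (Nat.factorial (2 * j) : ℝ)) := by
    intro j
    rw [hKdef]
    simp only
    rw [show m + ((2 * j : ℕ) : ℝ) / 2 = m + j by push_cast; ring]
  have hKo : ∀ j : ℕ, K (2 * j + 1) = C * (Gamma (m + 1 / 2 + j) ^ 2 * (2 * ρ) ^ (2 * j + 1) /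
      (Nat.factorial (2 * j + 1) : ℝ)) := by
    intro j
    rw [hKdef]
    simp only
    rw [show m + ((2 * j + 1 : ℕ) : ℝ) / 2 = m + 1 / 2 + j by push_cast; ring]
  have hK : Summable fun k => |K k| := by
    refine (HasSum.even_add_odd (f := fun k => |K k|) (Summable.hasSum ?_) (Summable.hasSum ?_)).summable
    · simp_rw [hKe, abs_mul C]
      exact (aux_summable_K hm0 hρa 0).mul_left _
    · simp_rw [hKo, abs_mul C]
      exact (aux_summable_K (show 0 < m + 1 / 2 by linarith) hρa 1).mul_left _
  -- the density as a series
  have hf : ∀ (p : ℕ) (r : ℝ), r ^ p * fisherDensity n ρ r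
      = ∑' k, K k * (r ^ (k + p) * auxW a r) := by
    intro p r
    unfold fisherDensity auxW
    split_ifs with h
    · rw [← tsum_mul_left, ← tsum_mul_left]
      refine tsum_congr fun k => ?_
      rw [hKdef, hC]
      simp only
      rw [show (n:ℝ) - 3 = 2 * m - 2 by linarith, show ((n:ℝ) - 1) / 2 = m by linarith,
        show ((n:ℝ) - 4) / 2 = a by linarith, show (n:ℝ) - 2 = 2 * m - 1 by linarith,
        show ((n:ℝ) - 1 + k) / 2 = m + k / 2 by rw [hnm]; ring, pow_add,
        show 2 * r * ρ = r * (2 * ρ) by ring, mul_pow r]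
      ring
    · simp
  -- moments
  have hB := aux_binom hm0 hu0 hu1
  have hq : (0:ℝ) < (1 - ρ ^ 2) ^ m := rpow_pos_of_pos (by linarith) _
  have hGm : 0 < Gamma m := Gamma_pos_of_pos hm0
  obtain ⟨c, hc⟩ : ∃ c : ℝ, c = (1 - ρ ^ 2) ^ m / Gamma m := ⟨_, rfl⟩
  have hc0 : 0 ≤ c := by rw [hc]; positivity
  have hone : HasSum (fun j : ℕ => c * (Gamma (m + j) * (ρ ^ 2) ^ j / (Nat.factorial j : ℝ))) 1 := by
    have := hB.mul_left c
    convert! this using 1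
    rw [hc, rpow_neg (by linarith)]
    field_simp
  obtain ⟨hI0, hS0⟩ := aux_moment ha hK 0
  obtain ⟨hI1, hS1⟩ := aux_moment ha hK 1
  simp_rw [← hf] at hI0 hS0 hI1 hS1
  simp only [pow_zero, one_mul, pow_one] at hI0 hS0 hI1 hS1
  have hint1 : ∫ r, fisherDensity n ρ r = 1 := by
    have hinj : Function.Injective (fun j : ℕ => 2 * j) := fun x y h => by simpa using h
    rw [← hinj.hasSum_iff] at hS0
    · refine hS0.unique ?_
      convert! hone using 1
      funext j
      simp only [Function.comp, add_zero]
      rw [aux_J_even ha, hKe, hC, ha1, aux_even_coef hm1, hc]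
    · intro k hk
      obtain ⟨j, rfl⟩ : ∃ j, k = 2 * j + 1 := by
        rcases Nat.even_or_odd' k with ⟨j, h | h⟩
        · exact absurd ⟨j, h.symm⟩ hk
        · exact ⟨j, h⟩
      rw [add_zero, aux_J_odd, mul_zero]
  have hmean : HasSum (fun j : ℕ => ρ * (c * (Gamma (m + j + 1 / 2) ^ 2 / Gamma (m + j + 1) *
      (ρ ^ 2) ^ j / (Nat.factorial j : ℝ)))) (∫ r, r * fisherDensity n ρ r) := by
    have hinj : Function.Injective (fun j : ℕ => 2 * j + 1) := fun x y h => by simpa using h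
    rw [← hinj.hasSum_iff] at hS1
    · convert! hS1 using 1
      funext j
      simp only [Function.comp]
      rw [show 2 * j + 1 + 1 = 2 * (j + 1) by ring, aux_J_even ha, hKo, hC, ha1]
      push_cast
      rw [aux_odd_coef hm1, hc]
    · intro k hk
      obtain ⟨j, rfl⟩ : ∃ j, k = 2 * j := by
        rcases Nat.even_or_odd' k with ⟨j, h | h⟩
        · exact ⟨j, h⟩
        · exact absurd ⟨j, h.symm⟩ hk
      rw [aux_J_odd, mul_zero]
  -- nonnegativity of the density
  have hmass : ∫⁻ r, ENNReal.ofReal (fisherDensity n ρ r) = 1 := by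
    have h1 : (Measure.map R P) Set.univ = 1 := by
      rw [Measure.map_apply hR MeasurableSet.univ]; simp
    rw [hlaw, withDensity_apply _ MeasurableSet.univ, Measure.restrict_univ] at h1
    exact h1
  have hpos : ∀ᵐ r, 0 ≤ fisherDensity n ρ r := by
    have h1 := integral_eq_lintegral_pos_part_sub_lintegral_neg_part hI0
    rw [hint1, hmass, ENNReal.toReal_one] at h1
    have h2 : (∫⁻ r, ENNReal.ofReal (-fisherDensity n ρ r)).toReal = 0 := by linarith
    rw [ENNReal.toReal_eq_zero_iff] at h2
    have h3 : ∫⁻ r, ENNReal.ofReal (-fisherDensity n ρ r) = 0 := by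
      refine h2.resolve_right ?_
      have := hI0.neg.lintegral_lt_top
      exact this.ne
    replace h3 := (lintegral_eq_zero_iff' hI0.aemeasurable.neg.ennreal_ofReal).mp h3
    filter_upwards [h3] with r hr
    simpa using hr
  have hE : ∫ ω, R ω ∂P = ∫ r, r * fisherDensity n ρ r := by
    have h1 : ∫ ω, R ω ∂P = ∫ r, r ∂(Measure.map R P) :=
      (integral_map hR.aemeasurable (f := fun r : ℝ => r) (by fun_prop)).symm
    rw [h1, hlaw, integral_withDensity_eq_integral_toReal_smul₀ hI0.aemeasurable.ennreal_ofReal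
      (Filter.Eventually.of_forall fun _ => ENNReal.ofReal_lt_top)]
    refine integral_congr_ae ?_
    filter_upwards [hpos] with r hr
    rw [ENNReal.toReal_ofReal hr, smul_eq_mul, mul_comm]
  rw [hE]
  -- compare the two series
  have hnn : ∀ j : ℕ, 0 ≤ Gamma (m + j) * (ρ ^ 2) ^ j / (Nat.factorial j : ℝ) := fun j => by
    have := Gamma_pos_of_pos (show 0 < m + j by positivity)
    positivity
  have hup : ∀ j : ℕ, c * (Gamma (m + j + 1 / 2) ^ 2 / Gamma (m + j + 1) *
      (ρ ^ 2) ^ j / (Nat.factorial j : ℝ)) ≤ c * (Gamma (m + j) * (ρ ^ 2) ^ j /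
        (Nat.factorial j : ℝ)) := by
    intro j
    have := aux_gamma_upper (show 0 < m + j by positivity)
    gcongr
  have hlo : ∀ j : ℕ, (1 - 1 / (n:ℝ)) * (c * (Gamma (m + j) * (ρ ^ 2) ^ j /
        (Nat.factorial j : ℝ))) ≤ c * (Gamma (m + j + 1 / 2) ^ 2 / Gamma (m + j + 1) *
      (ρ ^ 2) ^ j / (Nat.factorial j : ℝ)) := by
    intro j
    have hp : 0 < m + j := by positivity
    have h1 := aux_gamma_lower hp
    have hg := Gamma_pos_of_pos hp
    have h2 : (1 - 1 / (n:ℝ)) * Gamma (m + j) ≤ Gamma (m + j + 1 / 2) ^ 2 / Gamma (m + j + 1) := by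
      refine le_trans (mul_le_mul_of_nonneg_right ?_ hg.le) h1
      have : 1 / (2 * (m + j) + 1) ≤ 1 / (n:ℝ) := by
        apply one_div_le_one_div_of_le hn0
        rw [hnm]
        have : (0:ℝ) ≤ j := by positivity
        linarith
      linarith
    calc _ = c * ((1 - 1 / (n:ℝ)) * Gamma (m + j) * (ρ ^ 2) ^ j / (Nat.factorial j : ℝ)) := by ring
      _ ≤ _ := by gcongr
  have hn1 : 1 / (n:ℝ) ≤ 1 := by rw [div_le_one hn0]; linarith
  have hsum : Summable fun j : ℕ => c * (Gamma (m + j + 1 / 2) ^ 2 / Gamma (m + j + 1) *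
      (ρ ^ 2) ^ j / (Nat.factorial j : ℝ)) := by
    refine hone.summable.of_nonneg_of_le (fun j => le_trans ?_ (hlo j)) hup
    exact mul_nonneg (by linarith) (mul_nonneg hc0 (hnn j))
  obtain ⟨g, hg⟩ := hsum
  have hgu : g ≤ 1 := hasSum_le hup hg hone
  have hgl : (1 - 1 / (n:ℝ)) * 1 ≤ g := hasSum_le hlo (hone.mul_left _) hg
  rw [hmean.unique (hg.mul_left ρ)]
  rw [show ρ * g - ρ = ρ * (g - 1) by ring, abs_mul, div_eq_mul_one_div]
  gcongr
  rw [abs_le]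
  constructor
  · linarith
  · have : 0 < 1 / (n:ℝ) := by positivity
    linarith
end

section
/- Let n ≥ 3 be an integer, ρ ∈ (-1,1), and let R be a real random variable with law f_{n,ρ}. Then Var(R) = E[R²] - (E[R])² ≤ 1/(n-1). -/
open MeasureTheory Real

open ProbabilityTheory
open Filter Topology

lemma gamma_logconv {a b : ℝ} (ha : 0 < a) (hb : 0 < b) :
    Gamma ((a + b) / 2) ^ 2 ≤ Gamma a * Gamma b := by
  have h := Real.Gamma_mul_add_mul_le_rpow_Gamma_mul_rpow_Gamma ha hb
    (a := 1 / 2) (b := 1 / 2) (by norm_num) (by norm_num) (by norm_num)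
  have e : 1 / 2 * a + 1 / 2 * b = (a + b) / 2 := by ring
  rw [e, ← Real.sqrt_eq_rpow, ← Real.sqrt_eq_rpow] at h
  have h0 : 0 ≤ Gamma ((a + b) / 2) := (Real.Gamma_pos_of_pos (by linarith)).le
  calc Gamma ((a + b) / 2) ^ 2 ≤ (√(Gamma a) * √(Gamma b)) ^ 2 := by gcongr
    _ = Gamma a * Gamma b := by
      rw [mul_pow, Real.sq_sqrt (Real.Gamma_pos_of_pos ha).le,
        Real.sq_sqrt (Real.Gamma_pos_of_pos hb).le]

/-- the squared ratio `(Γ(x+1/2)/Γ(x))²` -/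
noncomputable def gq (x : ℝ) : ℝ := (Gamma (x + 1 / 2)) ^ 2 / (Gamma x) ^ 2

lemma gq_lower {x : ℝ} (hx : 1 ≤ x) : x - 1 / 2 ≤ gq x := by
  have hG : 0 < Gamma x := Real.Gamma_pos_of_pos (by linarith)
  have hG2 : 0 < Gamma (x - 1 / 2) := Real.Gamma_pos_of_pos (by linarith)
  have h := gamma_logconv (a := x - 1 / 2) (b := x + 1 / 2) (by linarith) (by linarith)
  have e : (x - 1 / 2 + (x + 1 / 2)) / 2 = x := by ring
  rw [e] at h
  have e2 : Gamma (x + 1 / 2) = (x - 1 / 2) * Gamma (x - 1 / 2) := by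
    rw [← Real.Gamma_add_one (by linarith)]; congr 1; ring
  rw [gq, le_div_iff₀ (by positivity)]
  rw [e2] at h ⊢
  have : 0 < x - 1 / 2 := by linarith
  nlinarith

lemma gq_succ {x : ℝ} (hx : 1 ≤ x) : gq (x + 1) * x ^ 2 = gq x * (x + 1 / 2) ^ 2 := by
  have hG : Gamma x ≠ 0 := (Real.Gamma_pos_of_pos (by linarith)).ne'
  have e2 : Gamma (x + 1 + 1 / 2) = (x + 1 / 2) * Gamma (x + 1 / 2) := by
    rw [← Real.Gamma_add_one (by linarith)]; congr 1; ring
  have hx0 : x ≠ 0 := by linarith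
  rw [gq, gq, e2, Real.Gamma_add_one hx0]
  field_simp

lemma gq_nonneg (x : ℝ) : 0 ≤ gq x := by unfold gq; positivity

lemma gq_step {x : ℝ} (hx : 1 ≤ x) :
    gq (x + 1) / (x + 1 - 1 / 4) ≤ gq x / (x - 1 / 4) := by
  rw [div_le_div_iff₀ (by linarith) (by linarith)]
  have h := gq_succ hx
  have h0 := gq_nonneg x
  have hx2 : 0 < x ^ 2 := by positivity
  refine le_of_mul_le_mul_right ?_ hx2
  calc gq (x + 1) * (x - 1 / 4) * x ^ 2 = gq x * ((x + 1 / 2) ^ 2 * (x - 1 / 4)) := by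
        linear_combination (x - 1 / 4) * h
    _ ≤ gq x * ((x + 1 - 1 / 4) * x ^ 2) := by
        refine mul_le_mul_of_nonneg_left ?_ h0
        nlinarith
    _ = gq x * (x + 1 - 1 / 4) * x ^ 2 := by ring

lemma gq_bound {x : ℝ} (hx : 1 ≤ x) : x - 1 / 4 ≤ gq x := by
  have h1 : ∀ k : ℕ, gq (x + k) / (x + k - 1 / 4) ≤ gq x / (x - 1 / 4) := by
    intro k
    induction k with
    | zero => simp
    | succ k ih =>
      have := gq_step (x := x + k) (by linarith [Nat.cast_nonneg (α := ℝ) k])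
      push_cast
      rw [← add_assoc]
      exact this.trans ih
  have h2 : ∀ k : ℕ, 1 - (1 / 4) / (x + k - 1 / 4) ≤ gq x / (x - 1 / 4) := by
    intro k
    refine le_trans ?_ (h1 k)
    have hk := Nat.cast_nonneg (α := ℝ) k
    have := gq_lower (x := x + k) (by linarith)
    have hp : 0 < x + k - 1 / 4 := by linarith
    rw [le_div_iff₀ hp, sub_mul, div_mul_cancel₀ _ hp.ne']
    linarith
  have h3 : Tendsto (fun k : ℕ => 1 - (1 / 4) / (x + (k : ℝ) - 1 / 4)) atTop (𝓝 (1 - 0)) := by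
    refine tendsto_const_nhds.sub ?_
    refine Tendsto.div_atTop tendsto_const_nhds ?_
    have : Tendsto (fun k : ℕ => (x - 1 / 4) + (k : ℝ)) atTop atTop :=
      tendsto_atTop_add_const_left _ _ tendsto_natCast_atTop_atTop
    refine this.congr fun k => by ring
  have h4 := le_of_tendsto' h3 h2
  rw [sub_zero, le_div_iff₀ (by linarith)] at h4
  linarith

lemma core_ineq (m ρ : ℝ) (hm : 1 ≤ m) (hq : ρ ^ 2 < 1) (p g : ℕ → ℝ) (hp : ∀ j, 0 ≤ p j)
    (hp1 : HasSum p 1) (hrec : ∀ j : ℕ, ((j : ℝ) + 1) * p (j + 1) = ρ ^ 2 * (j + m) * p j)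
    (hg : ∀ j : ℕ, 1 - 1 / (4 * (j + m)) ≤ g j) (E1 E2 : ℝ)
    (h1 : HasSum (fun j => ρ * (p j * g j)) E1)
    (h2 : HasSum (fun j : ℕ => p j * ((j + 1 / 2) / (j + m))) E2) :
    E2 - E1 ^ 2 ≤ 1 / (2 * m) := by
  have hx : ∀ j : ℕ, 1 ≤ (j : ℝ) + m := fun j => by linarith [Nat.cast_nonneg (α := ℝ) j]
  set q := ρ ^ 2 with hqdef
  have hq0 : 0 ≤ q := sq_nonneg ρ
  have hS : ∀ N, ∑ j ∈ Finset.range N, p j ≤ 1 := fun N => sum_le_hasSum _ (fun j _ => hp j) hp1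
  -- partial first moment
  have hT : ∀ N, (1 - q) * ∑ j ∈ Finset.range N, p j * (j + m) ≤ m := by
    intro N
    have hle : ∑ j ∈ Finset.range N, p j * ((j : ℝ) + m) ≤
        ∑ j ∈ Finset.range (N + 1), p j * ((j : ℝ) + m) :=
      Finset.sum_le_sum_of_subset_of_nonneg (Finset.range_mono (Nat.le_succ N))
        (fun j _ _ => mul_nonneg (hp j) (by linarith [hx j]))
    have e1 : ∑ j ∈ Finset.range (N + 1), p j * ((j : ℝ) + m) =
        q * ∑ j ∈ Finset.range N, p j * ((j : ℝ) + m) + m * ∑ j ∈ Finset.range (N + 1), p j := by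
      have : ∑ j ∈ Finset.range (N + 1), p j * ((j : ℝ) + m) =
          ∑ j ∈ Finset.range (N + 1), (j : ℝ) * p j + m * ∑ j ∈ Finset.range (N + 1), p j := by
        rw [Finset.mul_sum, ← Finset.sum_add_distrib]
        exact Finset.sum_congr rfl fun j _ => by ring
      rw [this, Finset.sum_range_succ' (fun j => (j : ℝ) * p j)]
      congr 1
      rw [Finset.mul_sum]
      simp only [Nat.cast_zero, zero_mul, add_zero]
      refine Finset.sum_congr rfl fun j _ => ?_
      push_cast
      rw [hrec j]; ring
    have := hS (N + 1)
    nlinarith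
  have hys : Summable fun j : ℕ => p j / (j + m) := by
    refine Summable.of_nonneg_of_le (fun j => div_nonneg (hp j) (by linarith [hx j])) (fun j => ?_)
      hp1.summable
    exact div_le_self (hp j) (hx j)
  obtain ⟨y, hy⟩ := hys
  have hy1 : y ≤ 1 := hasSum_le (fun j => div_le_self (hp j) (hx j)) hy hp1
  have hy0 : (1 - q) / m ≤ y := by
    set a := (1 - q) / m with ha
    have ha0 : 0 ≤ a := div_nonneg (by linarith) (by linarith)
    have hb : ∀ N, 2 * a * ∑ j ∈ Finset.range N, p j - a ≤ y := by
      intro N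
      have hyN : ∑ j ∈ Finset.range N, p j / ((j : ℝ) + m) ≤ y :=
        sum_le_hasSum _ (fun j _ => div_nonneg (hp j) (by linarith [hx j])) hy
      have : 2 * a * ∑ j ∈ Finset.range N, p j -
          a ^ 2 * ∑ j ∈ Finset.range N, p j * ((j : ℝ) + m) ≤
          ∑ j ∈ Finset.range N, p j / ((j : ℝ) + m) := by
        rw [Finset.mul_sum, Finset.mul_sum, ← Finset.sum_sub_distrib]
        refine Finset.sum_le_sum fun j _ => ?_
        have hxj : 0 < (j : ℝ) + m := by linarith [hx j]
        rw [le_div_iff₀ hxj]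
        nlinarith [mul_nonneg (hp j) (sq_nonneg (a * ((j : ℝ) + m) - 1))]
      have h3 : a ^ 2 * ∑ j ∈ Finset.range N, p j * ((j : ℝ) + m) ≤ a := by
        have := hT N
        have h4 : a * ∑ j ∈ Finset.range N, p j * ((j : ℝ) + m) ≤ 1 := by
          rw [ha, div_mul_eq_mul_div, div_le_one (by linarith)]; exact this
        nlinarith
      linarith
    have hl : Tendsto (fun N => 2 * a * ∑ j ∈ Finset.range N, p j - a) atTop
        (𝓝 (2 * a * 1 - a)) := (hp1.tendsto_sum_nat.const_mul _).sub_const _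
    have := le_of_tendsto' hl hb
    linarith
  have hE2 : E2 = 1 - (m - 1 / 2) * y := by
    refine h2.unique ?_
    have := hp1.sub (hy.mul_left (m - 1 / 2))
    refine this.congr_fun fun j => ?_
    have hxj : (j : ℝ) + m ≠ 0 := by linarith [hx j]
    field_simp
    ring
  have hE1 : q * (1 - y / 4) ≤ ρ * E1 := by
    have hA := (hp1.sub (hy.div_const 4)).mul_left q
    have hB := h1.mul_left ρ
    refine hasSum_le (fun j => ?_) hA hB
    have hxj : 0 < (j : ℝ) + m := by linarith [hx j]
    have : p j - p j / ((j : ℝ) + m) / 4 ≤ p j * g j := by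
      have := mul_le_mul_of_nonneg_left (hg j) (hp j)
      refine le_trans (le_of_eq ?_) this
      field_simp
    calc q * (p j - p j / ((j : ℝ) + m) / 4) ≤ q * (p j * g j) := by gcongr
      _ = ρ * (ρ * (p j * g j)) := by rw [hqdef]; ring
  have hE1' : q * (1 - y / 4) ^ 2 ≤ E1 ^ 2 := by
    rcases hq0.eq_or_lt with h | h
    · rw [← h]; nlinarith [sq_nonneg E1]
    · have h5 : 0 ≤ q * (1 - y / 4) := mul_nonneg hq0 (by linarith)
      have h6 : (q * (1 - y / 4)) ^ 2 ≤ (ρ * E1) ^ 2 := by gcongr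
      rw [mul_pow, mul_pow, ← hqdef] at h6
      refine le_of_mul_le_mul_left ?_ h
      linarith
  have hmm : m * (1 / m) = 1 := by field_simp
  have hay : (1 - q) * (1 / m) ≤ y := by rw [mul_one_div]; exact hy0
  have hgoal : 1 / (2 * m) = (1 / m) / 2 := by ring
  rw [hE2, hgoal]
  set u := 1 / m with hu
  have hu0 : 0 < u := by positivity
  have hu1 : u ≤ 1 := by rw [hu, div_le_one (by linarith)]; exact hm
  -- monotone in y
  have hA : 1 - (m - 1 / 2) * y - q * (1 - y / 4) ^ 2 ≤ u / 2 := by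
    have step1 : 1 - (m - 1 / 2) * y - q * (1 - y / 2) ≤ u / 2 := by
      have : (m - 1 / 2 - q / 2) * ((1 - q) * u) ≤ (m - 1 / 2 - q / 2) * y := by
        apply mul_le_mul_of_nonneg_left hay; linarith
      have e : (m - 1 / 2 - q / 2) * ((1 - q) * u) = (1 - q) - (1 + q) / 2 * (1 - q) * u := by
        linear_combination (1 - q) * hmm
      nlinarith [mul_nonneg (mul_nonneg hq0 hq0) hu0.le]
    nlinarith [mul_nonneg hq0 (sq_nonneg y)]
  linarith

/-- power series coefficients -/
noncomputable def cf (m ρ : ℝ) (k : ℕ) : ℝ :=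
  (Gamma (m + (k : ℝ) / 2)) ^ 2 * (2 * ρ) ^ k / (Nat.factorial k : ℝ)

lemma cf_add_two (m ρ : ℝ) (hm : 1 ≤ m) (k : ℕ) :
    cf m ρ (k + 2) * ((k + 1) * (k + 2)) = cf m ρ k * ((2 * m + k) ^ 2 * ρ ^ 2) := by
  have hk := Nat.cast_nonneg (α := ℝ) k
  have e : m + ((k + 2 : ℕ) : ℝ) / 2 = (m + (k : ℝ) / 2) + 1 := by push_cast; ring
  have hf : (Nat.factorial k : ℝ) ≠ 0 := by positivity
  rw [cf, cf, e, Real.Gamma_add_one (by linarith), Nat.factorial_succ, Nat.factorial_succ]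
  push_cast
  have h1 : (k : ℝ) + 1 ≠ 0 := by linarith
  have h2 : (k : ℝ) + 1 + 1 ≠ 0 := by linarith
  field_simp
  ring

lemma cf_succ (m ρ : ℝ) (hm : 1 ≤ m) (k : ℕ) :
    cf m ρ (k + 1) * (k + 1) = cf m ρ k * (2 * ρ * gq (m + (k : ℝ) / 2)) := by
  have hk := Nat.cast_nonneg (α := ℝ) k
  have e : m + ((k + 1 : ℕ) : ℝ) / 2 = (m + (k : ℝ) / 2) + 1 / 2 := by push_cast; ring
  have hf : (Nat.factorial k : ℝ) ≠ 0 := by positivity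
  have hG : Gamma (m + (k : ℝ) / 2) ≠ 0 := (Real.Gamma_pos_of_pos (by linarith)).ne'
  have h1 : (k : ℝ) + 1 ≠ 0 := by linarith
  rw [cf, cf, gq, e, Nat.factorial_succ]
  push_cast
  field_simp
  ring

lemma cf_ratio (m ρ : ℝ) (hm : 1 ≤ m) (hq : ρ ^ 2 < 1) :
    ∃ K : ℕ, ∀ k ≥ K, ‖cf m ρ (k + 2)‖ ≤ (1 + ρ ^ 2) / 2 * ‖cf m ρ k‖ := by
  have h1q : 0 < 1 - ρ ^ 2 := by linarith
  obtain ⟨K, hK⟩ := exists_nat_ge (16 * m ^ 2 / (1 - ρ ^ 2))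
  refine ⟨K + 1, fun k hk => ?_⟩
  have hkK : (K : ℝ) + 1 ≤ k := by exact_mod_cast hk
  have hk1 : (1 : ℝ) ≤ k := by linarith [Nat.cast_nonneg (α := ℝ) K]
  have hk2 : 16 * m ^ 2 ≤ k * (1 - ρ ^ 2) := by
    rw [← div_le_iff₀ h1q]; linarith
  have h := congrArg norm (cf_add_two m ρ hm k)
  rw [norm_mul, norm_mul (cf m ρ k),
    Real.norm_of_nonneg (by positivity : (0 : ℝ) ≤ (k + 1) * (k + 2)),
    Real.norm_of_nonneg (by positivity : (0 : ℝ) ≤ (2 * m + k) ^ 2 * ρ ^ 2)] at h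
  refine le_of_mul_le_mul_right ?_ (by positivity : (0 : ℝ) < (k + 1) * (k + 2))
  rw [h]
  have hc := norm_nonneg (cf m ρ k)
  have key : (2 * m + k) ^ 2 * ρ ^ 2 ≤ (1 + ρ ^ 2) / 2 * ((k + 1) * (k + 2)) := by
    have hq0 := sq_nonneg ρ
    have a1 : 16 * m ^ 2 * k ≤ k * (1 - ρ ^ 2) * k :=
      mul_le_mul_of_nonneg_right hk2 (by linarith)
    have a2 : (m : ℝ) * k ≤ m ^ 2 * k :=
      mul_le_mul_of_nonneg_right (by nlinarith) (by linarith)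
    have a3 : m ^ 2 ≤ m ^ 2 * k := by nlinarith [sq_nonneg m]
    have a4 : (4 * m ^ 2 + 4 * m * k) * ρ ^ 2 ≤ (4 * m ^ 2 + 4 * m * k) * 1 := by
      apply mul_le_mul_of_nonneg_left hq.le; positivity
    have a5 : (1 + ρ ^ 2) / 2 * ((k : ℝ) * k) ≤ (1 + ρ ^ 2) / 2 * ((k + 1) * (k + 2)) := by
      apply mul_le_mul_of_nonneg_left _ (by positivity); nlinarith
    nlinarith
  calc ‖cf m ρ k‖ * ((2 * m + k) ^ 2 * ρ ^ 2)
      ≤ ‖cf m ρ k‖ * ((1 + ρ ^ 2) / 2 * ((k + 1) * (k + 2))) := by gcongr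
    _ = _ := by ring

lemma cf_summable (m ρ : ℝ) (hm : 1 ≤ m) (hq : ρ ^ 2 < 1) : Summable (cf m ρ) := by
  obtain ⟨K, hK⟩ := cf_ratio m ρ hm hq
  have hr : (1 + ρ ^ 2) / 2 < 1 := by linarith
  refine Summable.even_add_odd ?_ ?_
  · refine summable_of_ratio_norm_eventually_le hr ?_
    filter_upwards [eventually_ge_atTop K] with j hj
    exact hK (2 * j) (by omega)
  · refine summable_of_ratio_norm_eventually_le hr ?_
    filter_upwards [eventually_ge_atTop K] with j hj
    exact hK (2 * j + 1) (by omega)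

lemma cf_mul (m ρ r : ℝ) (k : ℕ) : cf m (ρ * r) k = cf m ρ k * r ^ k := by
  rw [cf, cf, ← mul_assoc, mul_pow]; ring

lemma cf_norm (m ρ : ℝ) (k : ℕ) : ‖cf m ρ k‖ = cf m |ρ| k := by
  rw [cf, cf, norm_div, norm_mul, norm_pow, norm_pow, norm_mul]
  simp

/-- the series is nonnegative -/
lemma cf_tsum_nonneg (m t : ℝ) (hm : 1 ≤ m) (ht : t ^ 2 < 1) : 0 ≤ ∑' k, cf m t k := by
  let φ : ℕ → ℝ → ℝ := fun k x => Real.exp (-x) * x ^ (m + (k : ℝ) / 2 - 1)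
  have hpos : ∀ k : ℕ, 0 < m + (k : ℝ) / 2 := fun k => by
    linarith [Nat.cast_nonneg (α := ℝ) k]
  let μ := (volume.restrict (Set.Ioi (0 : ℝ)))
  have hφi : ∀ k, Integrable (φ k) μ := fun k => Real.GammaIntegral_convergent (hpos k)
  have hφ : ∀ k, ∫ x, φ k x ∂μ = Gamma (m + (k : ℝ) / 2) := fun k =>
    (Real.Gamma_eq_integral (hpos k)).symm
  let F : ℕ → ℝ × ℝ → ℝ := fun k z => (φ k z.1 * φ k z.2) * ((2 * t) ^ k / (Nat.factorial k : ℝ))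
  have hFi : ∀ k, Integrable (F k) (μ.prod μ) := fun k =>
    ((hφi k).mul_prod (hφi k)).mul_const _
  have hF : ∀ k, ∫ z, F k z ∂(μ.prod μ) = cf m t k := by
    intro k
    simp only [F]
    rw [integral_mul_const, integral_prod_mul, hφ, cf]
    ring
  have hae : ∀ᵐ z ∂(μ.prod μ), 0 < z.1 ∧ 0 < z.2 := by
    have h1 : ∀ᵐ x ∂μ, 0 < x := ae_restrict_mem measurableSet_Ioi
    have a := (Measure.quasiMeasurePreserving_fst (μ := μ) (ν := μ)).ae h1
    have b := (Measure.quasiMeasurePreserving_snd (μ := μ) (ν := μ)).ae h1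
    filter_upwards [a, b] with z h h' using ⟨h, h'⟩
  have hFn : ∀ k, ∫ z, ‖F k z‖ ∂(μ.prod μ) = ‖cf m t k‖ := by
    intro k
    have : ∫ z, ‖F k z‖ ∂(μ.prod μ) =
        ∫ z, (φ k z.1 * φ k z.2) * ‖(2 * t) ^ k / (Nat.factorial k : ℝ)‖ ∂(μ.prod μ) := by
      refine integral_congr_ae ?_
      filter_upwards [hae] with z hz
      have hz1 := hz.1
      have hz2 := hz.2
      simp only [F, φ]
      rw [norm_mul, Real.norm_of_nonneg]
      positivity
    rw [this, integral_mul_const, integral_prod_mul, hφ, cf, mul_div_assoc, norm_mul,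
      Real.norm_of_nonneg (sq_nonneg _), sq]
  have hsum : Summable fun k => ∫ z, ‖F k z‖ ∂(μ.prod μ) := by
    simp only [hFn]
    exact (cf_summable m t hm ht).norm
  have h := hasSum_integral_of_summable_integral_norm hFi hsum
  simp only [hF] at h
  rw [h.tsum_eq]
  refine integral_nonneg_of_ae ?_
  filter_upwards [hae] with z hz
  obtain ⟨h1, h2⟩ := hz
  have hval : HasSum (fun k => F k z)
      ((Real.exp (-z.1) * z.1 ^ (m - 1)) * (Real.exp (-z.2) * z.2 ^ (m - 1)) *
        Real.exp (2 * t * (√z.1 * √z.2))) := by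
    have := (NormedSpace.expSeries_div_hasSum_exp (2 * t * (√z.1 * √z.2))).mul_left
      ((Real.exp (-z.1) * z.1 ^ (m - 1)) * (Real.exp (-z.2) * z.2 ^ (m - 1)))
    rw [← Real.exp_eq_exp_ℝ] at this
    refine this.congr_fun fun k => ?_
    have hs : ∀ x : ℝ, 0 < x → x ^ (m + (k : ℝ) / 2 - 1) = x ^ (m - 1) * √x ^ k := by
      intro x hx
      rw [Real.sqrt_eq_rpow, ← Real.rpow_natCast, ← Real.rpow_mul hx.le, ← Real.rpow_add hx]
      congr 1; ring
    simp only [F, φ]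
    rw [hs _ h1, hs _ h2, mul_pow (2 * t) (√z.1 * √z.2), mul_pow (√z.1)]
    ring
  rw [hval.tsum_eq]
  simp only [Pi.zero_apply]
  positivity

/-- moments of the weight -/
noncomputable def mom (m : ℝ) (k : ℕ) : ℝ :=
  ∫ r in (-1 : ℝ)..1, r ^ k * (1 - r ^ 2) ^ (m - 3 / 2)

lemma one_sub_sq_pos {r : ℝ} (hr : r ∈ Set.Ioo (-1 : ℝ) 1) : 0 < 1 - r ^ 2 := by
  nlinarith [hr.1, hr.2]

lemma wt_meas (m : ℝ) (k : ℕ) : Measurable fun r : ℝ => r ^ k * (1 - r ^ 2) ^ (m - 3 / 2) := by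
  fun_prop

lemma ae_Ioo : ∀ᵐ r ∂(volume.restrict (Set.Ioc (-1 : ℝ) 1)), r ∈ Set.Ioo (-1 : ℝ) 1 := by
  rw [← restrict_Ioo_eq_restrict_Ioc]
  exact ae_restrict_mem measurableSet_Ioo

lemma wt_int (m : ℝ) (hm : 1 ≤ m) (k : ℕ) :
    IntegrableOn (fun r : ℝ => r ^ k * (1 - r ^ 2) ^ (m - 3 / 2)) (Set.Ioc (-1) 1) := by
  have h0 : IntegrableOn (fun r : ℝ => 1 / √(1 - r ^ 2)) (Set.Ioc (-1) 1) := by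
    refine intervalIntegral.integrableOn_deriv_of_nonneg
      Real.continuous_arcsin.continuousOn (fun x hx => ?_) (fun x _ => by positivity)
    exact Real.hasDerivAt_arcsin hx.1.ne' hx.2.ne
  refine Integrable.mono' h0 (wt_meas m k).aestronglyMeasurable ?_
  filter_upwards [ae_Ioo] with r hr
  have hp := one_sub_sq_pos hr
  rw [norm_mul, norm_pow, Real.norm_of_nonneg (Real.rpow_nonneg hp.le _), one_div,
    Real.sqrt_eq_rpow, ← Real.rpow_neg hp.le]
  have h1 : ‖r‖ ^ k ≤ 1 := pow_le_one₀ (norm_nonneg _) (abs_le.2 ⟨hr.1.le, hr.2.le⟩)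
  have h2 : (1 - r ^ 2) ^ (m - 3 / 2) ≤ (1 - r ^ 2) ^ (-(1 / 2) : ℝ) :=
    Real.rpow_le_rpow_of_exponent_ge hp (by nlinarith) (by linarith)
  calc _ ≤ 1 * (1 - r ^ 2) ^ (-(1 / 2) : ℝ) := by gcongr
    _ = _ := one_mul _

lemma wt_iint (m : ℝ) (hm : 1 ≤ m) (k : ℕ) :
    IntervalIntegrable (fun r : ℝ => r ^ k * (1 - r ^ 2) ^ (m - 3 / 2)) volume (-1) 1 :=
  (intervalIntegrable_iff_integrableOn_Ioc_of_le (by norm_num)).2 (wt_int m hm k)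

lemma hasDeriv_wt (m : ℝ) {r : ℝ} (hr : r ∈ Set.Ioo (-1 : ℝ) 1) :
    HasDerivAt (fun r : ℝ => (1 - r ^ 2) ^ (m - 1 / 2))
      (-(2 * m - 1) * (r * (1 - r ^ 2) ^ (m - 3 / 2))) r := by
  have hp := one_sub_sq_pos hr
  have h : HasDerivAt (fun r : ℝ => 1 - r ^ 2) (-(2 * r)) r := by
    simpa using (hasDerivAt_pow 2 r).const_sub 1
  have := h.rpow_const (p := m - 1 / 2) (Or.inl hp.ne')
  convert this using 1
  rw [show m - 1 / 2 - 1 = m - 3 / 2 by ring]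
  ring

lemma wt_cont (m : ℝ) (hm : 1 ≤ m) : Continuous fun r : ℝ => (1 - r ^ 2) ^ (m - 1 / 2) :=
  Continuous.rpow_const (by fun_prop) (fun _ => Or.inr (by linarith))

lemma mom_one (m : ℝ) (hm : 1 ≤ m) : mom m 1 = 0 := by
  have h := intervalIntegral.integral_eq_sub_of_hasDerivAt_of_le (a := -1) (b := 1)
    (f := fun r : ℝ => (1 - r ^ 2) ^ (m - 1 / 2))
    (f' := fun r => -(2 * m - 1) * (r ^ 1 * (1 - r ^ 2) ^ (m - 3 / 2))) (by norm_num)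
    (wt_cont m hm).continuousOn
    (fun r hr => by simpa using hasDeriv_wt m hr) ((wt_iint m hm 1).const_mul _)
  rw [intervalIntegral.integral_const_mul] at h
  simp only [even_two, Even.neg_pow, sub_self] at h
  rcases mul_eq_zero.1 h with h | h
  · linarith
  · exact h

lemma mom_rec (m : ℝ) (hm : 1 ≤ m) (k : ℕ) :
    mom m (k + 2) * (k + 2 * m) = (k + 1) * mom m k := by
  have hd : ∀ r ∈ Set.Ioo (-1 : ℝ) 1, HasDerivAt (fun r : ℝ => r ^ (k + 1) * (1 - r ^ 2) ^ (m - 1 / 2))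
      (((k : ℝ) + 1) * (r ^ k * (1 - r ^ 2) ^ (m - 3 / 2)) -
        (k + 2 * m) * (r ^ (k + 2) * (1 - r ^ 2) ^ (m - 3 / 2))) r := by
    intro r hr
    have hp := one_sub_sq_pos hr
    have h := (hasDerivAt_pow (k + 1) r).mul (hasDeriv_wt m hr)
    refine h.congr_deriv ?_
    have e : (1 - r ^ 2) ^ (m - 1 / 2) = (1 - r ^ 2) * (1 - r ^ 2) ^ (m - 3 / 2) := by
      rw [← Real.rpow_one_add' hp.le (by linarith)]
      congr 1; ring
    rw [e]
    push_cast
    ring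
  have h := intervalIntegral.integral_eq_sub_of_hasDerivAt_of_le (a := -1) (b := 1) (by norm_num)
    (((continuous_pow (k + 1)).mul (wt_cont m hm)).continuousOn) hd
    (((wt_iint m hm k).const_mul _).sub ((wt_iint m hm (k + 2)).const_mul _))
  rw [intervalIntegral.integral_sub ((wt_iint m hm k).const_mul _)
    ((wt_iint m hm (k + 2)).const_mul _), intervalIntegral.integral_const_mul,
    intervalIntegral.integral_const_mul] at h
  have hz : (0 : ℝ) ^ (m - 1 / 2) = 0 := Real.zero_rpow (by linarith)
  have hl : (fun r : ℝ => r ^ (k + 1) * (1 - r ^ 2) ^ (m - 1 / 2)) 1 -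
      (fun r : ℝ => r ^ (k + 1) * (1 - r ^ 2) ^ (m - 1 / 2)) (-1) = 0 := by
    simp only [even_two, Even.neg_pow, one_pow, sub_self, hz, mul_zero]
  replace h := h.trans hl
  change ((k : ℝ) + 1) * mom m k - (k + 2 * m) * mom m (k + 2) = 0 at h
  linarith

lemma mom_odd (m : ℝ) (hm : 1 ≤ m) (j : ℕ) : mom m (2 * j + 1) = 0 := by
  induction j with
  | zero => exact mom_one m hm
  | succ j ih =>
    have h := mom_rec m hm (2 * j + 1)
    rw [ih, mul_zero] at h
    rcases mul_eq_zero.1 h with h | h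
    · exact h
    · exfalso
      have := Nat.cast_nonneg (α := ℝ) (2 * j + 1)
      linarith

lemma mom_even_nonneg (m : ℝ) (j : ℕ) : 0 ≤ mom m (2 * j) := by
  refine intervalIntegral.integral_nonneg (by norm_num) fun r hr => ?_
  refine mul_nonneg ?_ (Real.rpow_nonneg (by nlinarith [hr.1, hr.2]) _)
  rw [pow_mul]; positivity

/-- series for the moments -/
lemma series_mom (m ρ : ℝ) (hm : 1 ≤ m) (hq : ρ ^ 2 < 1) (l : ℕ) :
    HasSum (fun k => cf m ρ k * mom m (k + l))
      (∫ r in Set.Ioc (-1 : ℝ) 1, r ^ l * (1 - r ^ 2) ^ (m - 3 / 2) * ∑' k, cf m (ρ * r) k) := by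
  have hs := (cf_summable m ρ hm hq).norm
  have hb : ∀ r : ℝ, (∑' k, ‖cf m ρ k‖ * (r ^ 0 * (1 - r ^ 2) ^ (m - 3 / 2))) =
      (∑' k, ‖cf m ρ k‖) * (r ^ 0 * (1 - r ^ 2) ^ (m - 3 / 2)) := fun r => tsum_mul_right
  have h := hasSum_integral_of_dominated_convergence
    (μ := volume.restrict (Set.Ioc (-1 : ℝ) 1))
    (F := fun k r => cf m ρ k * (r ^ (k + l) * (1 - r ^ 2) ^ (m - 3 / 2)))
    (f := fun r => r ^ l * (1 - r ^ 2) ^ (m - 3 / 2) * ∑' k, cf m (ρ * r) k)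
    (fun k r => ‖cf m ρ k‖ * (r ^ 0 * (1 - r ^ 2) ^ (m - 3 / 2)))
    (fun k => ((wt_meas m (k + l)).const_mul _).aestronglyMeasurable)
    (fun k => ?_) (Eventually.of_forall fun r => hs.mul_right _) ?_ ?_
  · refine h.congr_fun fun k => ?_
    rw [integral_const_mul, mom, intervalIntegral.integral_of_le (by norm_num)]
  · filter_upwards [ae_Ioo] with r hr
    have hp := one_sub_sq_pos hr
    rw [norm_mul, norm_mul, norm_pow, Real.norm_of_nonneg (Real.rpow_nonneg hp.le _), pow_zero]
    have h1 : ‖r‖ ^ (k + l) ≤ 1 := pow_le_one₀ (norm_nonneg _) (abs_le.2 ⟨hr.1.le, hr.2.le⟩)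
    gcongr
  · simp only [hb]
    exact (wt_int m hm 0).const_mul _
  · filter_upwards [ae_Ioo] with r hr
    have hp := one_sub_sq_pos hr
    have hqr : (ρ * r) ^ 2 < 1 := by
      rw [mul_pow]; nlinarith [sq_nonneg ρ, sq_nonneg r]
    refine ((cf_summable m (ρ * r) hm hqr).hasSum.mul_left
      (r ^ l * (1 - r ^ 2) ^ (m - 3 / 2))).congr_fun fun k => ?_
    rw [cf_mul, pow_add]; ring

/-- normalizing constant -/
noncomputable def fC (n : ℕ) (ρ : ℝ) : ℝ :=
  2 ^ ((n : ℝ) - 3) * (1 - ρ ^ 2) ^ (((n : ℝ) - 1) / 2) / (π * Gamma ((n : ℝ) - 2))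

lemma fC_nonneg (n : ℕ) (hn : 3 ≤ n) (ρ : ℝ) (hq : ρ ^ 2 < 1) : 0 ≤ fC n ρ := by
  have h3 : (3 : ℝ) ≤ n := by exact_mod_cast hn
  have := Real.Gamma_pos_of_pos (s := (n : ℝ) - 2) (by linarith)
  have h1 : 0 < 1 - ρ ^ 2 := by linarith
  unfold fC
  positivity

lemma fisher_eq (n : ℕ) (ρ r : ℝ) (hr : |r| < 1) :
    fisherDensity n ρ r = fC n ρ * ((1 - r ^ 2) ^ (((n : ℝ) - 1) / 2 - 3 / 2) *
      ∑' k, cf (((n : ℝ) - 1) / 2) (ρ * r) k) := by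
  have e : ∀ k : ℕ, cf (((n : ℝ) - 1) / 2) (ρ * r) k =
      (Gamma (((n : ℝ) - 1 + (k : ℝ)) / 2)) ^ 2 * (2 * r * ρ) ^ k / (Nat.factorial k : ℝ) := by
    intro k
    rw [cf, add_div, show 2 * (ρ * r) = 2 * r * ρ by ring]
  rw [fisherDensity, if_pos hr]
  simp only [e]
  rw [fC, show ((n : ℝ) - 1) / 2 - 3 / 2 = ((n : ℝ) - 4) / 2 by ring]
  ring

lemma mul_sq_lt {ρ r : ℝ} (hq : ρ ^ 2 < 1) (hr : |r| < 1) : (ρ * r) ^ 2 < 1 := by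
  have : r ^ 2 < 1 := (sq_lt_one_iff_abs_lt_one r).2 hr
  rw [mul_pow]; nlinarith [sq_nonneg ρ, sq_nonneg r]

lemma fisher_nonneg (n : ℕ) (hn : 3 ≤ n) (ρ : ℝ) (hq : ρ ^ 2 < 1) (r : ℝ) :
    0 ≤ fisherDensity n ρ r := by
  have h3 : (3 : ℝ) ≤ n := by exact_mod_cast hn
  by_cases hr : |r| < 1
  · rw [fisher_eq n ρ r hr]
    have hr2 : r ^ 2 < 1 := (sq_lt_one_iff_abs_lt_one r).2 hr
    exact mul_nonneg (fC_nonneg n hn ρ hq) (mul_nonneg (Real.rpow_nonneg (by linarith) _)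
      (cf_tsum_nonneg _ _ (by linarith) (mul_sq_lt hq hr)))
  · rw [fisherDensity, if_neg hr]

lemma fisher_meas (n : ℕ) (hn : 3 ≤ n) (ρ : ℝ) (hq : ρ ^ 2 < 1) :
    Measurable (fisherDensity n ρ) := by
  have h3 : (3 : ℝ) ≤ n := by exact_mod_cast hn
  refine measurable_of_tendsto_metrizable (f := fun (N : ℕ) (r : ℝ) => if |r| < 1 then
    fC n ρ * ((1 - r ^ 2) ^ (((n : ℝ) - 1) / 2 - 3 / 2) *
      ∑ k ∈ Finset.range N, cf (((n : ℝ) - 1) / 2) ρ k * r ^ k) else 0) (fun N => ?_) ?_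
  · refine Measurable.ite (measurableSet_lt (by fun_prop) measurable_const) ?_ measurable_const
    fun_prop
  · rw [tendsto_pi_nhds]
    intro r
    by_cases hr : |r| < 1
    · simp only [hr, if_true]
      rw [fisher_eq n ρ r hr]
      have := (cf_summable (((n : ℝ) - 1) / 2) (ρ * r) (by linarith)
        (mul_sq_lt hq hr)).hasSum.tendsto_sum_nat
      simp only [cf_mul] at this ⊢
      exact (this.const_mul _).const_mul _
    · simp only [hr, if_false, fisherDensity]
      exact tendsto_const_nhds

lemma even_sum {f : ℕ → ℝ} {S : ℝ} (h : HasSum f S) (h0 : ∀ j, f (2 * j + 1) = 0) :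
    HasSum (fun j => f (2 * j)) S := by
  have hi : Function.Injective (fun j : ℕ => 2 * j) := fun a b h => by simpa using h
  refine (hi.hasSum_iff (f := f) ?_).2 h
  intro x hx
  rcases Nat.even_or_odd' x with ⟨c, rfl | rfl⟩
  · exact absurd ⟨c, rfl⟩ hx
  · exact h0 c

lemma odd_sum {f : ℕ → ℝ} {S : ℝ} (h : HasSum f S) (h0 : ∀ j, f (2 * j) = 0) :
    HasSum (fun j => f (2 * j + 1)) S := by
  have hi : Function.Injective (fun j : ℕ => 2 * j + 1) := fun a b h => by simpa using h
  refine (hi.hasSum_iff (f := f) ?_).2 h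
  intro x hx
  rcases Nat.even_or_odd' x with ⟨c, rfl | rfl⟩
  · exact h0 c
  · exact absurd ⟨c, rfl⟩ hx

lemma fisher_moment {Ω : Type*} [MeasurableSpace Ω] (P : Measure Ω)
    (n : ℕ) (hn : 3 ≤ n) (ρ : ℝ) (hq : ρ ^ 2 < 1) (R : Ω → ℝ) (hR : Measurable R)
    (hlaw : Measure.map R P = volume.withDensity fun r => ENNReal.ofReal (fisherDensity n ρ r))
    (l : ℕ) :
    HasSum (fun k => fC n ρ * (cf (((n : ℝ) - 1) / 2) ρ k * mom (((n : ℝ) - 1) / 2) (k + l)))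
      (∫ ω, (R ω) ^ l ∂P) := by
  have h3 : (3 : ℝ) ≤ n := by exact_mod_cast hn
  have h := (series_mom (((n : ℝ) - 1) / 2) ρ (by linarith) hq l).mul_left (fC n ρ)
  suffices hE : ∫ ω, (R ω) ^ l ∂P = fC n ρ * ∫ r in Set.Ioc (-1 : ℝ) 1,
      r ^ l * (1 - r ^ 2) ^ (((n : ℝ) - 1) / 2 - 3 / 2) *
        ∑' k, cf (((n : ℝ) - 1) / 2) (ρ * r) k by
    rw [hE]; exact h
  have e1 : ∫ ω, (R ω) ^ l ∂P = ∫ x, x ^ l ∂(Measure.map R P) :=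
    (integral_map hR.aemeasurable (f := fun x : ℝ => x ^ l)
      (measurable_id.pow_const l).aestronglyMeasurable).symm
  rw [e1, hlaw, integral_withDensity_eq_integral_toReal_smul
    (fisher_meas n hn ρ hq).ennreal_ofReal (Eventually.of_forall fun _ => ENNReal.ofReal_lt_top),
    ← integral_const_mul, integral_Ioc_eq_integral_Ioo, ← integral_indicator measurableSet_Ioo]
  refine integral_congr_ae (Eventually.of_forall fun r => ?_)
  simp only
  rw [ENNReal.toReal_ofReal (fisher_nonneg n hn ρ hq r)]
  by_cases hr : |r| < 1
  · have : r ∈ Set.Ioo (-1 : ℝ) 1 := abs_lt.1 hr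
    rw [Set.indicator_of_mem this, fisher_eq n ρ r hr, smul_eq_mul]
    ring
  · have : r ∉ Set.Ioo (-1 : ℝ) 1 := fun h => hr (abs_lt.2 h)
    rw [Set.indicator_of_notMem this, fisherDensity, if_neg hr, zero_smul]

open ProbabilityTheory

/-- The variance of the sample correlation coefficient is at most `1/(n-1)`. -/
theorem variance_le {Ω : Type*} [MeasurableSpace Ω] (P : Measure Ω) [IsProbabilityMeasure P]
    (n : ℕ) (hn : 3 ≤ n) (ρ : ℝ) (hρ : ρ ∈ Set.Ioo (-1 : ℝ) 1)
    (R : Ω → ℝ) (hR : Measurable R)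
    (hlaw : Measure.map R P = volume.withDensity fun r => ENNReal.ofReal (fisherDensity n ρ r)) :
    variance R P = (∫ ω, (R ω) ^ 2 ∂P) - (∫ ω, R ω ∂P) ^ 2 ∧
      variance R P ≤ 1 / ((n : ℝ) - 1) := by
  have hq : ρ ^ 2 < 1 := by nlinarith [hρ.1, hρ.2]
  have h3 : (3 : ℝ) ≤ n := by exact_mod_cast hn
  have hbd : ∀ᵐ ω ∂P, ‖R ω‖ ≤ 1 := by
    have : ∀ᵐ x ∂(Measure.map R P), ‖x‖ ≤ 1 := by
      rw [hlaw, ae_withDensity_iff (fisher_meas n hn ρ hq).ennreal_ofReal]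
      refine Eventually.of_forall fun x hx => ?_
      by_contra hcon
      apply hx
      rw [fisherDensity, if_neg (fun h => hcon h.le), ENNReal.ofReal_zero]
    exact ae_of_ae_map hR.aemeasurable this
  have hL : MemLp R 2 P := MemLp.of_bound hR.aestronglyMeasurable 1 hbd
  have hvar : variance R P = (∫ ω, (R ω) ^ 2 ∂P) - (∫ ω, R ω ∂P) ^ 2 := by
    rw [variance_eq_sub hL]; rfl
  refine ⟨hvar, ?_⟩
  rw [hvar]
  have m0 := fisher_moment P n hn ρ hq R hR hlaw 0
  have m1 := fisher_moment P n hn ρ hq R hR hlaw 1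
  have m2 := fisher_moment P n hn ρ hq R hR hlaw 2
  simp only [pow_zero, pow_one, integral_const, probReal_univ, smul_eq_mul, mul_one,
    add_zero] at m0 m1
  set m := ((n : ℝ) - 1) / 2 with hmdef
  have hm : 1 ≤ m := by rw [hmdef]; linarith
  have hx : ∀ j : ℕ, 1 ≤ (j : ℝ) + m := fun j => by linarith [Nat.cast_nonneg (α := ℝ) j]
  have hCn := fC_nonneg n hn ρ hq
  have s0 := even_sum m0 (fun j => by rw [mom_odd m hm]; ring)
  have s1 := odd_sum m1 (fun j => by rw [mom_odd m hm]; ring)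
  have s2 := even_sum m2 (fun j => by
    rw [show 2 * j + 1 + 2 = 2 * (j + 1) + 1 by ring, mom_odd m hm]; ring)
  have hmom : ∀ j : ℕ, mom m (2 * j + 2) = mom m (2 * j) * (((j : ℝ) + 1 / 2) / (j + m)) := by
    intro j
    have h := mom_rec m hm (2 * j)
    push_cast at h
    have := hx j
    have hne : (j : ℝ) + m ≠ 0 := by linarith
    field_simp
    linarith
  have hfin := core_ineq m ρ hm hq (fun j => fC n ρ * (cf m ρ (2 * j) * mom m (2 * j)))
    (fun j => gq (j + m) / (j + m)) ?_ s0 ?_ ?_ (∫ ω, R ω ∂P) (∫ ω, (R ω) ^ 2 ∂P) ?_ ?_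
  · calc _ ≤ 1 / (2 * m) := hfin
      _ = 1 / ((n : ℝ) - 1) := by rw [hmdef]; congr 1; ring
  · intro j
    refine mul_nonneg hCn (mul_nonneg ?_ (mom_even_nonneg m j))
    rw [cf, pow_mul]
    positivity
  · intro j
    have h := cf_add_two m ρ hm (2 * j)
    have hne : (j : ℝ) + m ≠ 0 := by linarith [hx j]
    have hj : (0 : ℝ) < 2 * j + 1 := by positivity
    push_cast at h
    have h' : cf m ρ (2 * j + 2) * (2 * j + 1) * (j + 1) =
        2 * (cf m ρ (2 * j) * ((m + j) ^ 2 * ρ ^ 2)) := by linear_combination h / 2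
    rw [show 2 * (j + 1) = 2 * j + 2 by ring, hmom]
    field_simp
    linear_combination (fC n ρ * mom m (2 * j)) * h'
  · intro j
    have h := gq_bound (hx j)
    have hp : 0 < (j : ℝ) + m := by linarith [hx j]
    rw [le_div_iff₀ hp]
    have : (1 - 1 / (4 * ((j : ℝ) + m))) * (j + m) = j + m - 1 / 4 := by field_simp
    linarith
  · refine s1.congr_fun fun j => ?_
    have h := cf_succ m ρ hm (2 * j)
    have e : m + ((2 * j : ℕ) : ℝ) / 2 = j + m := by push_cast; ring
    rw [e] at h
    push_cast at h
    have hne : (j : ℝ) + m ≠ 0 := by linarith [hx j]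
    rw [show 2 * j + 1 + 1 = 2 * j + 2 by ring, hmom]
    field_simp
    linear_combination -(fC n ρ * mom m (2 * j)) * h
  · refine s2.congr_fun fun j => ?_
    rw [hmom]; ring
end

section
/- Let n ≥ 3 be an integer, ρ ∈ (-1,1), and let R be a real random variable with law f_{n,ρ}. Then for every integer m ≥ 1, E[R^{2m}] ≥ (3/(n+1))^{m-1} · E[R²]. -/
open MeasureTheory Real

open Filter Topology Set in
lemma summable_of_two_step {u : ℕ → ℝ} (hu : ∀ k, 0 < u k) {L : ℝ} (hL : L < 1)
    (h : Tendsto (fun k => u (k + 2) / u k) atTop (𝓝 L)) : Summable u := by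
  have he : Summable (fun k => u (2 * k)) := by
    refine summable_of_ratio_test_tendsto_lt_one hL
      (Eventually.of_forall fun k => (hu _).ne') ?_
    have h2 : Tendsto (fun k : ℕ => 2 * k) atTop atTop :=
      tendsto_atTop_mono (fun k => by simp only [id]; omega) tendsto_id
    refine (h.comp h2).congr fun k => ?_
    simp only [Function.comp, Real.norm_of_nonneg (hu _).le]
    rw [show 2 * (k + 1) = 2 * k + 2 by ring]
  have ho : Summable (fun k => u (2 * k + 1)) := by
    refine summable_of_ratio_test_tendsto_lt_one hL
      (Eventually.of_forall fun k => (hu _).ne') ?_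
    have h2 : Tendsto (fun k : ℕ => 2 * k + 1) atTop atTop :=
      tendsto_atTop_mono (fun k => by simp only [id]; omega) tendsto_id
    refine (h.comp h2).congr fun k => ?_
    simp only [Function.comp, Real.norm_of_nonneg (hu _).le]
    rw [show 2 * (k + 1) + 1 = 2 * k + 1 + 2 by ring]
  exact (he.hasSum.even_add_odd ho.hasSum).summable

lemma gamma_two_step {c : ℝ} (hc : 0 < c) (k : ℕ) :
    Gamma ((c + ((k + 2 : ℕ) : ℝ)) / 2) = (c + k) / 2 * Gamma ((c + k) / 2) := by
  rw [← Gamma_add_one (by positivity)]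
  congr 1
  push_cast
  ring

lemma fact_two_step (k : ℕ) :
    ((Nat.factorial (k + 2) : ℕ) : ℝ) = (k + 2) * (k + 1) * (Nat.factorial k : ℝ) := by
  rw [Nat.factorial_succ, Nat.factorial_succ]
  push_cast
  ring

open Filter Topology Set in
lemma tendsto_aux (c b : ℝ) :
    Tendsto (fun k : ℕ => (c + k) / ((k : ℝ) + b)) atTop (𝓝 1) := by
  have := tendsto_add_mul_div_add_mul_atTop_nhds c b (1 : ℝ) (d := 1) one_ne_zero
  simp only [one_mul, div_one] at this
  refine this.congr fun k => ?_
  rw [add_comm b]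

open Filter Topology Set in
lemma summable_S1 {c : ℝ} (hc : 0 < c) (x : ℝ) :
    Summable (fun k : ℕ => Gamma ((c + k) / 2) * |x| ^ k / (Nat.factorial k : ℝ)) := by
  have hg : ∀ k : ℕ, 0 < Gamma ((c + k) / 2) := fun k => Gamma_pos_of_pos (by positivity)
  have hy : 0 < |x| + 1 := by positivity
  set y := |x| + 1
  have hs : Summable (fun k : ℕ => Gamma ((c + k) / 2) * y ^ k / (Nat.factorial k : ℝ)) := by
    refine summable_of_two_step (L := 0) (fun k => ?_) (by norm_num) ?_
    · have := hg k
      positivity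
    · have h1 := (tendsto_aux c 1)
      have h2 : Tendsto (fun k : ℕ => (1:ℝ) / ((k : ℝ) + 2)) atTop (𝓝 0) := by
        have := tendsto_add_mul_div_add_mul_atTop_nhds (1:ℝ) 2 (0 : ℝ) (d := 1) one_ne_zero
        simp only [zero_mul, add_zero, one_mul, zero_div] at this
        refine this.congr fun k => ?_
        rw [add_comm]
      have h3 := (h1.mul h2).mul_const (y ^ 2 / 2)
      rw [mul_zero, zero_mul] at h3
      refine h3.congr fun k => ?_
      have := (hg k).ne'
      rw [gamma_two_step hc, fact_two_step]
      have h4 : ((Nat.factorial k : ℕ) : ℝ) ≠ 0 := by positivity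
      field_simp
      ring
  refine hs.of_nonneg_of_le (fun k => ?_) (fun k => ?_)
  · have := hg k
    positivity
  · have := hg k
    have : |x| ≤ y := by simp [y]
    gcongr

open Filter Topology Set in
lemma summable_S2 {c : ℝ} (hc : 0 < c) (x : ℝ) (hx : |x| < 2) :
    Summable (fun k : ℕ => Gamma ((c + k) / 2) ^ 2 * |x| ^ k / (Nat.factorial k : ℝ)) := by
  have hg : ∀ k : ℕ, 0 < Gamma ((c + k) / 2) := fun k => Gamma_pos_of_pos (by positivity)
  obtain ⟨y, hy1, hy2⟩ := exists_between hx
  have hy : 0 < y := (abs_nonneg x).trans_lt hy1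
  have hs : Summable (fun k : ℕ => Gamma ((c + k) / 2) ^ 2 * y ^ k / (Nat.factorial k : ℝ)) := by
    refine summable_of_two_step (L := y ^ 2 / 4) (fun k => ?_) (by nlinarith) ?_
    · have := hg k
      positivity
    · have h1 := (tendsto_aux c 1)
      have h2 := (tendsto_aux c 2)
      have h3 := (h1.mul h2).mul_const (y ^ 2 / 4)
      rw [one_mul, one_mul] at h3
      refine h3.congr fun k => ?_
      have := (hg k).ne'
      rw [gamma_two_step hc, fact_two_step]
      have h4 : ((Nat.factorial k : ℕ) : ℝ) ≠ 0 := by positivity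
      field_simp
      ring
  refine hs.of_nonneg_of_le (fun k => ?_) (fun k => ?_)
  · have := hg k
    positivity
  · have := hg k
    gcongr

open Filter Topology Set in
lemma nonneg_step {c : ℝ} (hc : 0 < c) (d : ℕ → ℝ)
    (hd : Summable (fun k : ℕ => |d k| * Gamma ((c + k) / 2)))
    (hpos : ∀ s : ℝ, 0 < s → 0 ≤ ∑' k, d k * s ^ k) :
    0 ≤ ∑' k : ℕ, d k * Gamma ((c + k) / 2) := by
  let F : ℕ → ℝ → ℝ := fun k t => d k * (Real.exp (-t) * t ^ ((c + k) / 2 - 1))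
  have hck : ∀ k : ℕ, 0 < (c + k) / 2 := fun k => by positivity
  have hint : ∀ k, Integrable (F k) (volume.restrict (Ioi 0)) := fun k =>
    (GammaIntegral_convergent (hck k)).const_mul _
  have hFint : ∀ k, ∫ t in Ioi 0, F k t = d k * Gamma ((c + k) / 2) := fun k => by
    rw [Gamma_eq_integral (hck k), ← integral_const_mul]
  have hnorm : ∀ k, ∫ t in Ioi 0, ‖F k t‖ = |d k| * Gamma ((c + k) / 2) := fun k => by
    rw [Gamma_eq_integral (hck k), ← integral_const_mul]
    refine setIntegral_congr_fun measurableSet_Ioi fun t ht => ?_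
    have ht : 0 < t := ht
    simp only [F, norm_mul, Real.norm_eq_abs, abs_exp, abs_of_pos (rpow_pos_of_pos ht _)]
  have key := hasSum_integral_of_summable_integral_norm hint (by simpa only [hnorm] using hd)
  simp only [hFint] at key
  rw [key.tsum_eq]
  refine setIntegral_nonneg measurableSet_Ioi fun t ht => ?_
  have ht : 0 < t := ht
  have : ∀ k, F k t = (Real.exp (-t) * t ^ (c / 2 - 1)) * (d k * (t ^ (1/2 : ℝ)) ^ k) := fun k => by
    simp only [F]
    rw [← rpow_natCast, ← rpow_mul ht.le, show (c + k) / 2 - 1 = (c/2-1) + 1 / 2 * (k:ℝ) by ring,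
      rpow_add ht]
    ring
  simp only [this]
  rw [tsum_mul_left]
  exact mul_nonneg (by positivity) (hpos _ (by positivity))

lemma series_nonneg {c : ℝ} (hc : 0 < c) (x : ℝ) (hx : |x| < 2) :
    0 ≤ ∑' k : ℕ, Gamma ((c + k) / 2) ^ 2 * x ^ k / (Nat.factorial k : ℝ) := by
  have hg : ∀ k : ℕ, 0 < Gamma ((c + k) / 2) := fun k => Gamma_pos_of_pos (by positivity)
  have h := nonneg_step hc (fun k => Gamma ((c + k) / 2) * x ^ k / (Nat.factorial k : ℝ)) ?_ ?_
  · refine h.trans_eq (tsum_congr fun k => ?_)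
    ring
  · refine (summable_S2 hc x hx).congr fun k => ?_
    rw [abs_div, abs_mul, abs_of_pos (hg k), abs_pow, Nat.abs_cast]
    ring
  · intro s hs
    have h := nonneg_step hc (fun k => (x * s) ^ k / (Nat.factorial k : ℝ)) ?_ ?_
    · refine h.trans_eq (tsum_congr fun k => ?_)
      rw [mul_pow]
      ring
    · refine (summable_S1 hc (x * s)).congr fun k => ?_
      rw [abs_div, abs_pow, Nat.abs_cast]
      ring
    · intro t ht
      have : ∑' k : ℕ, (x * s) ^ k / (Nat.factorial k : ℝ) * t ^ k = Real.exp (x * s * t) := by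
        rw [Real.exp_eq_exp_ℝ, NormedSpace.exp_eq_tsum_div]
        refine tsum_congr fun k => ?_
        rw [mul_pow (x * s)]
        ring
      rw [this]
      positivity

open Filter Topology Set in
lemma weight_integrable {p : ℝ} (hp : -(1/2) ≤ p) (s : ℕ) :
    IntegrableOn (fun r : ℝ => r ^ s * (1 - r ^ 2) ^ p) (Ioo (-1) 1) := by
  have h0 : IntegrableOn (fun r : ℝ => 1 / √(1 - r ^ 2)) (Ioo (-1) 1) := by
    rw [← integrableOn_Ioc_iff_integrableOn_Ioo]
    refine intervalIntegral.integrableOn_deriv_of_nonneg (g := arcsin) continuous_arcsin.continuousOn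
      (fun x hx => hasDerivAt_arcsin hx.1.ne' hx.2.ne) (fun x hx => by positivity)
  refine Integrable.mono' h0 (by fun_prop) ?_
  refine (ae_restrict_iff' measurableSet_Ioo).2 (Eventually.of_forall fun r hr => ?_)
  have h1 : |r| ≤ 1 := (abs_lt.2 hr).le
  have h2 : 0 < 1 - r ^ 2 := by nlinarith [hr.1, hr.2]
  have h3 : 1 - r ^ 2 ≤ 1 := by nlinarith
  rw [norm_mul, norm_pow, Real.norm_eq_abs, Real.norm_eq_abs, abs_of_pos (rpow_pos_of_pos h2 _)]
  have h4 : (1 - r ^ 2) ^ p ≤ (1 - r ^ 2) ^ (-(1/2) : ℝ) := rpow_le_rpow_of_exponent_ge h2 h3 hp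
  have h5 : (1 - r ^ 2) ^ (-(1/2) : ℝ) = 1 / √(1 - r ^ 2) := by
    rw [rpow_neg h2.le, sqrt_eq_rpow]
    exact (one_div _).symm
  rw [← h5]
  calc |r| ^ s * (1 - r ^ 2) ^ p ≤ 1 * (1 - r ^ 2) ^ p := by
        gcongr
        exact pow_le_one₀ (abs_nonneg _) h1
    _ ≤ _ := by rw [one_mul]; exact h4

open Filter Topology Set in
lemma weight_recurrence {p : ℝ} (hp : -(1/2) ≤ p) (s : ℕ) :
    (2 * s + 1 + 2 * (p + 1)) * ∫ r in Ioo (-1 : ℝ) 1, r ^ (2 * (s + 1)) * (1 - r ^ 2) ^ p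
      = (2 * s + 1) * ∫ r in Ioo (-1 : ℝ) 1, r ^ (2 * s) * (1 - r ^ 2) ^ p := by
  have hi1 := (weight_integrable hp (2 * s)).const_mul (2 * s + 1 : ℝ)
  have hi2 := (weight_integrable hp (2 * (s + 1))).const_mul (2 * s + 1 + 2 * (p + 1) : ℝ)
  have hd : ∀ r ∈ Ioo (-1 : ℝ) 1, HasDerivAt (fun r : ℝ => r ^ (2 * s + 1) * (1 - r ^ 2) ^ (p + 1))
      ((2 * s + 1) * (r ^ (2 * s) * (1 - r ^ 2) ^ p)
        - (2 * s + 1 + 2 * (p + 1)) * (r ^ (2 * (s + 1)) * (1 - r ^ 2) ^ p)) r := by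
    intro r hr
    have h2 : 0 < 1 - r ^ 2 := by nlinarith [hr.1, hr.2]
    have e1 := hasDerivAt_pow (2 * s + 1) r
    have e2 : HasDerivAt (fun r : ℝ => 1 - r ^ 2) (-(2 * r)) r := by
      simpa using (hasDerivAt_pow 2 r).const_sub 1
    have e3 := e1.mul (e2.rpow_const (p := p + 1) (Or.inl h2.ne'))
    refine e3.congr_deriv ?_
    rw [rpow_add h2, rpow_one]
    push_cast
    simp only [add_sub_cancel_right]
    ring
  have hcont : ContinuousOn (fun r : ℝ => r ^ (2 * s + 1) * (1 - r ^ 2) ^ (p + 1)) (Icc (-1) 1) := by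
    apply Continuous.continuousOn
    have : Continuous fun r : ℝ => (1 - r ^ 2) ^ (p + 1) :=
      Continuous.rpow_const (by fun_prop) (fun x => Or.inr (by linarith))
    fun_prop
  have hint := hi1.sub hi2
  have key := intervalIntegral.integral_eq_sub_of_hasDerivAt_of_le (by norm_num) hcont hd (by
    rw [intervalIntegrable_iff_integrableOn_Ioo_of_le (by norm_num)]
    exact hint)
  rw [intervalIntegral.integral_of_le (by norm_num), integral_Ioc_eq_integral_Ioo,
    integral_sub hi1 hi2, integral_const_mul, integral_const_mul] at key
  have hz : (0:ℝ) ^ (p + 1) = 0 := zero_rpow (by linarith)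
  norm_num [hz] at key
  linarith

open Filter Topology Set in
lemma weight_ineq {n : ℕ} (hn : 3 ≤ n) {s : ℕ} (hs : 1 ≤ s) :
    ENNReal.ofReal (3 / ((n : ℝ) + 1)) *
      ∫⁻ r in Ioo (-1 : ℝ) 1, ENNReal.ofReal (r ^ (2 * s) * (1 - r ^ 2) ^ (((n : ℝ) - 4) / 2))
    ≤ ∫⁻ r in Ioo (-1 : ℝ) 1,
        ENNReal.ofReal (r ^ (2 * (s + 1)) * (1 - r ^ 2) ^ (((n : ℝ) - 4) / 2)) := by
  have hn' : (3 : ℝ) ≤ n := by exact_mod_cast hn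
  have hs' : (1 : ℝ) ≤ s := by exact_mod_cast hs
  have hp : -(1/2) ≤ ((n : ℝ) - 4) / 2 := by linarith
  have hnn : ∀ j : ℕ, 0 ≤ᵐ[volume.restrict (Ioo (-1 : ℝ) 1)]
      (fun r : ℝ => r ^ (2 * j) * (1 - r ^ 2) ^ (((n : ℝ) - 4) / 2)) := fun j => by
    refine (ae_restrict_iff' measurableSet_Ioo).2 (Eventually.of_forall fun r hr => ?_)
    have h2 : 0 < 1 - r ^ 2 := by nlinarith [hr.1, hr.2]
    have : 0 ≤ r ^ (2 * j) := by rw [pow_mul]; positivity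
    simp only [Pi.zero_apply]
    positivity
  rw [← ofReal_integral_eq_lintegral_ofReal (weight_integrable hp _) (hnn s),
    ← ofReal_integral_eq_lintegral_ofReal (weight_integrable hp _) (hnn (s + 1)),
    ← ENNReal.ofReal_mul (by positivity)]
  apply ENNReal.ofReal_le_ofReal
  have hr := weight_recurrence hp s
  have hA := integral_nonneg_of_ae (hnn s)
  set A := ∫ r in Ioo (-1 : ℝ) 1, r ^ (2 * s) * (1 - r ^ 2) ^ (((n : ℝ) - 4) / 2)
  set B := ∫ r in Ioo (-1 : ℝ) 1, r ^ (2 * (s + 1)) * (1 - r ^ 2) ^ (((n : ℝ) - 4) / 2)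
  have hq : 2 * (s : ℝ) + 1 + 2 * (((n : ℝ) - 4) / 2 + 1) = 2 * s + n - 1 := by ring
  rw [hq] at hr
  have hpos : 0 < 2 * (s : ℝ) + n - 1 := by linarith
  have hB : B = (2 * s + 1) / (2 * s + n - 1) * A := by
    field_simp
    linarith
  rw [hB]
  refine mul_le_mul_of_nonneg_right ?_ hA
  rw [div_le_div_iff₀ (by positivity) hpos]
  nlinarith [mul_nonneg (sub_nonneg.2 hs') (by linarith : (0:ℝ) ≤ n - 2)]

/-- The normalising constant of Fisher's density. -/
noncomputable def fisherConst (n : ℕ) (ρ : ℝ) : ℝ :=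
  2 ^ ((n : ℝ) - 3) * (1 - ρ ^ 2) ^ (((n : ℝ) - 1) / 2) / (π * Gamma ((n : ℝ) - 2))

/-- The coefficients of the even part of Fisher's density. -/
noncomputable def fisherCoeff (n : ℕ) (ρ : ℝ) (j : ℕ) : ℝ :=
  2 * fisherConst n ρ * (Gamma (((n : ℝ) - 1 + ((2 * j : ℕ) : ℝ)) / 2) ^ 2 * (2 * ρ) ^ (2 * j) /
    (Nat.factorial (2 * j) : ℝ))

lemma fisherConst_nonneg {n : ℕ} (hn : 3 ≤ n) {ρ : ℝ} (hρ : ρ ∈ Set.Ioo (-1 : ℝ) 1) :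
    0 ≤ fisherConst n ρ := by
  have hn' : (3 : ℝ) ≤ n := by exact_mod_cast hn
  have h1 : 0 < 1 - ρ ^ 2 := by nlinarith [hρ.1, hρ.2]
  have h2 : 0 < Gamma ((n : ℝ) - 2) := Gamma_pos_of_pos (by linarith)
  unfold fisherConst
  positivity

lemma fisherCoeff_nonneg {n : ℕ} (hn : 3 ≤ n) {ρ : ℝ} (hρ : ρ ∈ Set.Ioo (-1 : ℝ) 1) (j : ℕ) :
    0 ≤ fisherCoeff n ρ j := by
  have h1 := fisherConst_nonneg hn hρ
  have h2 : 0 ≤ (2 * ρ) ^ (2 * j) := by rw [pow_mul]; positivity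
  unfold fisherCoeff
  positivity

lemma fisherDensity_eq {n : ℕ} {ρ r : ℝ} (hr : |r| < 1) :
    fisherDensity n ρ r = fisherConst n ρ * (1 - r ^ 2) ^ (((n : ℝ) - 4) / 2) *
      ∑' k : ℕ, Gamma (((n : ℝ) - 1 + (k : ℝ)) / 2) ^ 2 * (2 * r * ρ) ^ k /
        (Nat.factorial k : ℝ) := by
  unfold fisherDensity fisherConst
  rw [if_pos hr]
  ring

lemma arg_lt {ρ r : ℝ} (hρ : ρ ∈ Set.Ioo (-1 : ℝ) 1) (hr : |r| < 1) : |2 * r * ρ| < 2 := by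
  have h : |ρ| < 1 := abs_lt.2 hρ
  rw [abs_mul, abs_mul, abs_two]
  nlinarith [abs_nonneg ρ, abs_nonneg r, mul_lt_one_of_nonneg_of_lt_one_left (abs_nonneg r) hr h.le]

lemma fisherDensity_nonneg {n : ℕ} (hn : 3 ≤ n) {ρ : ℝ} (hρ : ρ ∈ Set.Ioo (-1 : ℝ) 1) (r : ℝ) :
    0 ≤ fisherDensity n ρ r := by
  have hn' : (3 : ℝ) ≤ n := by exact_mod_cast hn
  by_cases hr : |r| < 1
  · rw [fisherDensity_eq hr]
    have h1 := fisherConst_nonneg hn hρ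
    have h2 : 0 < 1 - r ^ 2 := by nlinarith [(abs_lt.1 hr).1, (abs_lt.1 hr).2]
    have h3 := series_nonneg (c := (n : ℝ) - 1) (by linarith) _ (arg_lt hρ hr)
    positivity
  · simp [fisherDensity, hr]

lemma fisherDensity_measurable (n : ℕ) (ρ : ℝ) : Measurable (fisherDensity n ρ) := by
  unfold fisherDensity
  refine Measurable.ite (measurableSet_lt (by fun_prop) (by fun_prop)) ?_ measurable_const
  refine Measurable.mul (by fun_prop) (Measurable.tsum fun k => by fun_prop)

lemma fisherDensity_symm {n : ℕ} (hn : 3 ≤ n) {ρ : ℝ} (hρ : ρ ∈ Set.Ioo (-1 : ℝ) 1) {r : ℝ}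
    (hr : |r| < 1) :
    HasSum (fun j : ℕ => fisherCoeff n ρ j * (r ^ (2 * j) * (1 - r ^ 2) ^ (((n : ℝ) - 4) / 2)))
      (fisherDensity n ρ r + fisherDensity n ρ (-r)) := by
  have hn' : (3 : ℝ) ≤ n := by exact_mod_cast hn
  let t : ℝ → ℕ → ℝ := fun x k => Gamma (((n : ℝ) - 1 + (k : ℝ)) / 2) ^ 2 * (2 * x * ρ) ^ k /
        (Nat.factorial k : ℝ)
  have hs : ∀ x : ℝ, |x| < 1 → Summable (t x) := fun x hx => by
    refine Summable.of_norm ((summable_S2 (c := (n : ℝ) - 1) (by linarith) _ (arg_lt hρ hx)).congr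
      fun k => ?_)
    simp [t, abs_div, abs_mul, abs_pow]
  have hr' : |-r| < 1 := by rwa [abs_neg]
  have h1 := ((hs r hr).hasSum.add (hs _ hr').hasSum).mul_left
    (fisherConst n ρ * (1 - r ^ 2) ^ (((n : ℝ) - 4) / 2))
  have h2 : fisherConst n ρ * (1 - r ^ 2) ^ (((n : ℝ) - 4) / 2) * (∑' k, t r k + ∑' k, t (-r) k)
      = fisherDensity n ρ r + fisherDensity n ρ (-r) := by
    rw [fisherDensity_eq hr, fisherDensity_eq hr', neg_sq]
    ring
  rw [h2] at h1
  have hinj : Function.Injective (fun j : ℕ => 2 * j) := fun a b h => by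
    simp only at h
    omega
  rw [← hinj.hasSum_iff] at h1
  · refine (congrArg (fun g : ℕ → ℝ => HasSum g _) (funext fun j => ?_)).mpr h1
    simp only [Function.comp, t, fisherCoeff]
    rw [show 2 * -r * ρ = -(2 * r * ρ) by ring, (even_two_mul j).neg_pow,
      show 2 * r * ρ = (2 * ρ) * r by ring, mul_pow (2 * ρ) r]
    ring
  · intro k hk
    have hk' : Odd k := by
      rw [← Nat.not_even_iff_odd]
      rintro ⟨a, ha⟩
      exact hk ⟨a, by simp only; omega⟩
    simp only [t]
    rw [show 2 * -r * ρ = -(2 * r * ρ) by ring, hk'.neg_pow]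
    ring

open Set in
lemma moment_eq {n : ℕ} (hn : 3 ≤ n) {ρ : ℝ} (hρ : ρ ∈ Set.Ioo (-1 : ℝ) 1) (m : ℕ) :
    2 * ∫⁻ r, ENNReal.ofReal (r ^ (2 * m))
        ∂(volume.withDensity fun r => ENNReal.ofReal (fisherDensity n ρ r))
      = ∑' j : ℕ, ENNReal.ofReal (fisherCoeff n ρ j) * ∫⁻ r in Ioo (-1 : ℝ) 1,
          ENNReal.ofReal (r ^ (2 * (j + m)) * (1 - r ^ 2) ^ (((n : ℝ) - 4) / 2)) := by
  have hfm := fisherDensity_measurable n ρ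
  have hnn := fisherDensity_nonneg hn hρ
  have hpe : ∀ r : ℝ, ∀ j : ℕ, 0 ≤ r ^ (2 * j) := fun r j => by rw [pow_mul]; positivity
  rw [lintegral_withDensity_eq_lintegral_mul _ hfm.ennreal_ofReal (by fun_prop)]
  simp only [Pi.mul_apply]
  have hneg := lintegral_neg_eq_self (μ := (volume : Measure ℝ))
    (fun r : ℝ => ENNReal.ofReal (fisherDensity n ρ r) * ENNReal.ofReal (r ^ (2 * m)))
  rw [two_mul]
  nth_rewrite 2 [← hneg]
  rw [← lintegral_add_left (by fun_prop)]
  have hstep : ∀ r : ℝ, ENNReal.ofReal (fisherDensity n ρ r) * ENNReal.ofReal (r ^ (2 * m)) +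
      ENNReal.ofReal (fisherDensity n ρ (-r)) * ENNReal.ofReal ((-r) ^ (2 * m)) =
      (Ioo (-1 : ℝ) 1).indicator (fun r => ∑' j : ℕ, ENNReal.ofReal (fisherCoeff n ρ j) *
        ENNReal.ofReal (r ^ (2 * (j + m)) * (1 - r ^ 2) ^ (((n : ℝ) - 4) / 2))) r := by
    intro r
    by_cases hr : r ∈ Ioo (-1 : ℝ) 1
    · rw [indicator_of_mem hr]
      have hr1 : |r| < 1 := abs_lt.2 hr
      have h2 : 0 < 1 - r ^ 2 := by nlinarith [hr.1, hr.2]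
      have hS := (fisherDensity_symm hn hρ hr1).mul_left (r ^ (2 * m))
      rw [(even_two_mul m).neg_pow, ← add_mul, ← ENNReal.ofReal_add (hnn _) (hnn _),
        ← ENNReal.ofReal_mul (add_nonneg (hnn _) (hnn _)), mul_comm, ← hS.tsum_eq,
        ENNReal.ofReal_tsum_of_nonneg _ hS.summable]
      · refine tsum_congr fun j => ?_
        rw [← ENNReal.ofReal_mul (fisherCoeff_nonneg hn hρ j)]
        congr 1
        rw [mul_add, pow_add]
        ring
      · intro j
        have := fisherCoeff_nonneg hn hρ j
        have := hpe r m
        have := hpe r j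
        positivity
    · rw [indicator_of_notMem hr]
      have hr1 : ¬ |r| < 1 := fun h => hr (abs_lt.1 h)
      simp [fisherDensity, hr1]
  simp only [hstep]
  rw [lintegral_indicator measurableSet_Ioo, lintegral_tsum (fun j => by fun_prop)]
  refine tsum_congr fun j => ?_
  rw [lintegral_const_mul _ (by fun_prop)]

lemma moment_step {n : ℕ} (hn : 3 ≤ n) {ρ : ℝ} (hρ : ρ ∈ Set.Ioo (-1 : ℝ) 1) {m : ℕ} (hm : 1 ≤ m) :
    ENNReal.ofReal (3 / ((n : ℝ) + 1)) * ∫⁻ r, ENNReal.ofReal (r ^ (2 * m))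
        ∂(volume.withDensity fun r => ENNReal.ofReal (fisherDensity n ρ r))
      ≤ ∫⁻ r, ENNReal.ofReal (r ^ (2 * (m + 1)))
        ∂(volume.withDensity fun r => ENNReal.ofReal (fisherDensity n ρ r)) := by
  rw [← ENNReal.mul_le_mul_iff_right (a := 2) (by norm_num) (by norm_num), mul_left_comm,
    moment_eq hn hρ, moment_eq hn hρ, ← ENNReal.tsum_mul_left]
  refine ENNReal.tsum_le_tsum fun j => ?_
  rw [mul_left_comm]
  gcongr
  exact weight_ineq hn (by omega)

/-- Lower bound for even moments of the sample correlation coefficient in terms of the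
second moment. -/
theorem even_moment_lower_bound {Ω : Type*} [MeasurableSpace Ω] (P : Measure Ω)
    [IsProbabilityMeasure P] (n : ℕ) (hn : 3 ≤ n) (ρ : ℝ) (hρ : ρ ∈ Set.Ioo (-1 : ℝ) 1)
    (R : Ω → ℝ) (hR : Measurable R)
    (hlaw : Measure.map R P = volume.withDensity fun r => ENNReal.ofReal (fisherDensity n ρ r))
    (m : ℕ) (hm : 1 ≤ m) :
    (3 / ((n : ℝ) + 1)) ^ (m - 1) * ∫ ω, (R ω) ^ 2 ∂P ≤ ∫ ω, (R ω) ^ (2 * m) ∂P := by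
  have hfm := fisherDensity_measurable n ρ
  have hbd : ∀ᵐ ω ∂P, |R ω| < 1 := by
    have h : ∀ᵐ r ∂(Measure.map R P), |r| < 1 := by
      rw [hlaw, ae_withDensity_iff hfm.ennreal_ofReal]
      refine Filter.Eventually.of_forall fun r hr => ?_
      by_contra hc
      exact hr (by simp [fisherDensity, hc])
    exact ae_of_ae_map hR.aemeasurable h
  have hpe : ∀ r : ℝ, ∀ j : ℕ, 0 ≤ r ^ (2 * j) := fun r j => by rw [pow_mul]; positivity
  have hint : ∀ j : ℕ, ∫ ω, (R ω) ^ (2 * j) ∂P =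
      (∫⁻ r, ENNReal.ofReal (r ^ (2 * j)) ∂(Measure.map R P)).toReal := fun j => by
    rw [integral_eq_lintegral_of_nonneg_ae (Filter.Eventually.of_forall fun ω => hpe _ _)
      (by fun_prop), lintegral_map (by fun_prop) hR]
  have hfin : ∀ j : ℕ, ∫⁻ r, ENNReal.ofReal (r ^ (2 * j)) ∂(Measure.map R P) ≠ ⊤ := fun j => by
    rw [lintegral_map (by fun_prop) hR]
    refine ne_top_of_le_ne_top (b := ∫⁻ ω, 1 ∂P) (by simp) (lintegral_mono_ae ?_)
    filter_upwards [hbd] with ω hω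
    rw [ENNReal.ofReal_le_one, pow_mul]
    exact pow_le_one₀ (sq_nonneg _) (by nlinarith [(abs_lt.1 hω).1, (abs_lt.1 hω).2])
  have hstep : ∀ j : ℕ, 1 ≤ j → 3 / ((n : ℝ) + 1) * ∫ ω, (R ω) ^ (2 * j) ∂P ≤
      ∫ ω, (R ω) ^ (2 * (j + 1)) ∂P := fun j hj => by
    have h := moment_step hn hρ hj
    rw [← hlaw] at h
    have h' := ENNReal.toReal_mono (hfin _) h
    rw [ENNReal.toReal_mul, ENNReal.toReal_ofReal (by positivity)] at h'
    rw [hint, hint]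
    exact h'
  induction m, hm using Nat.le_induction with
  | base => simp
  | succ k hk ih =>
    refine le_trans ?_ (hstep k hk)
    obtain ⟨l, rfl⟩ : ∃ l, k = l + 1 := ⟨k - 1, by omega⟩
    simp only [Nat.add_sub_cancel] at ih ⊢
    rw [pow_succ', mul_assoc]
    gcongr
end
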